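/- arXiv:1902.07873 — 2 statements merged into one kernel-verified Lean document; each statement's English description precedes it below -/
import Mathlib

section
/- Let G be the simple graph on six vertices v1,...,v6 whose edges are the path edges v1v2, v2v3, v3v4, v4v5, v5v6 together with the chords v3v5 and v4v6 (this is the graph G^6_63 in Harary's enumeration of six-vertex graphs). Then for every integer n ≥ 4, the crossing number of the Cartesian product G □ C_n equals 2n. -/
open SimpleGraph

/-- A drawing of a simple graph in the plane: vertices are mapped to distinct
points, and each edge is mapped to a simple arc (parametrised by `[0,1]`)
joining the images of its endpoints and avoiding the images of all vertices
in its interior. -/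
structure Drawing {V : Type*} (G : SimpleGraph V) where
  vertexMap : V → ℝ × ℝ
  vertexMap_injective : Function.Injective vertexMap
  arc : G.edgeSet → ℝ → ℝ × ℝ
  arc_continuousOn : ∀ e, ContinuousOn (arc e) (Set.Icc 0 1)
  arc_injOn : ∀ e, Set.InjOn (arc e) (Set.Icc 0 1)
  arc_endpoints : ∀ e : G.edgeSet, ∃ u v : V,
    (e : Sym2 V) = s(u, v) ∧ arc e 0 = vertexMap u ∧ arc e 1 = vertexMap v
  arc_avoids_vertices : ∀ e : G.edgeSet, ∀ t ∈ Set.Ioo (0 : ℝ) 1, ∀ w : V,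
    arc e t ≠ vertexMap w

/-- The crossings of a drawing: an unordered pair of distinct edges together
with a point of the plane where the two corresponding arcs intersect away
from their endpoints. -/
def Drawing.crossings {V : Type*} {G : SimpleGraph V} (D : Drawing G) :
    Set (Sym2 G.edgeSet × (ℝ × ℝ)) :=
  { x | ∃ e f : G.edgeSet, e ≠ f ∧ x.1 = s(e, f) ∧
      (∃ s ∈ Set.Ioo (0 : ℝ) 1, D.arc e s = x.2) ∧
      (∃ t ∈ Set.Ioo (0 : ℝ) 1, D.arc f t = x.2) }

/-- The crossing number of a simple graph: the minimum number of crossings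
over all drawings of the graph in the plane. -/
noncomputable def crossingNumber {V : Type*} (G : SimpleGraph V) : ℕ :=
  sInf { n : ℕ | ∃ D : Drawing G, D.crossings.Finite ∧ D.crossings.ncard = n }

/-- The graph `G⁶₆₃`: the path `v1 v2 v3 v4 v5 v6` together with the chords `v3v5` and `v4v6`. -/
def G6_63 : SimpleGraph (Fin 6) :=
  SimpleGraph.fromEdgeSet {s(0, 1), s(1, 2), s(2, 3), s(3, 4), s(4, 5), s(2, 4), s(3, 5)}

/-! ### Logarithms along paths -/

theorem exists_continuous_log {A : Type*} [TopologicalSpace A] [SimplyConnectedSpace A]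
    [LocallyPathConnectedSpace A] {f : A → ℂ} (hf : Continuous f) (h0 : ∀ a, f a ≠ 0) :
    ∃ g : A → ℂ, Continuous g ∧ ∀ a, Complex.exp (g a) = f a := by
  obtain ⟨a₀⟩ : Nonempty A := inferInstance
  obtain ⟨g, ⟨-, hg⟩, -⟩ := Complex.isCoveringMapOn_exp.existsUnique_continuousMap_lifts
    (⟨f, hf⟩ : C(A, ℂ)) (a₀ := a₀) (e₀ := Complex.log (f a₀)) (Complex.exp_log (h0 a₀))
    (fun a => h0 a)
  exact ⟨g, g.continuous, fun a => congrFun hg a⟩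

theorem sub_eq_sub_of_exp_eq_mul {g h : ℝ → ℂ} (hg : Continuous g) (hh : Continuous h) (c : ℂ)
    (H : ∀ t, Complex.exp (g t) = c * Complex.exp (h t)) (s t : ℝ) : g s - g t = h s - h t := by
  have := Complex.isCoveringMap_exp.const_of_comp (g := fun t => g t - h t) (by fun_prop)
    (fun a a' => Subtype.ext (by simp [Complex.exp_sub, H])) s t
  grind

/-- The number of extra turns a path makes around a point it avoids, relative to the difference of
the principal logarithms at its ends. -/
theorem exists_turns {γ : ℝ → ℂ} (hγ : Continuous γ) {w : ℂ} (hw : ∀ t, γ t ≠ w) :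
    ∃ k : ℤ, ∀ (c : ℂ) (g : ℝ → ℂ), Continuous g → (∀ t, Complex.exp (g t) = c * (γ t - w)) →
      g 1 - g 0 = Complex.log (γ 1 - w) - Complex.log (γ 0 - w) +
        k * (2 * Real.pi * Complex.I) := by
  obtain ⟨h, hc, hh⟩ := exists_continuous_log (f := fun t => γ t - w) (by fun_prop)
    (fun t => sub_ne_zero.2 (hw t))
  have h1 := Complex.exp_log (sub_ne_zero.2 (hw 1))
  have h0 := Complex.exp_log (sub_ne_zero.2 (hw 0))
  rw [← hh 1, Complex.exp_eq_exp_iff_exists_int, hh] at h1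
  rw [← hh 0, Complex.exp_eq_exp_iff_exists_int, hh] at h0
  obtain ⟨k₁, h1⟩ := h1
  obtain ⟨k₀, h0⟩ := h0
  refine ⟨k₀ - k₁, fun c g hg H => ?_⟩
  rw [sub_eq_sub_of_exp_eq_mul hg hc c (fun t => by rw [H, hh]), h1, h0]
  push_cast
  ring

open Classical in
/-- Which side of the horizontal line through `u` the point `v` lies on. -/
noncomputable def planeSide (u v : ℂ) : ℤ :=
  if 0 < (v - u).im ∨ (v - u).im = 0 ∧ (v - u).re < 0 then 1 else 0

theorem planeSide_cases {u v : ℂ} (h : u ≠ v) :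
    (planeSide u v = 1 ∧ planeSide v u = 0 ∧ (u - v).arg = (v - u).arg - Real.pi) ∨
      (planeSide u v = 0 ∧ planeSide v u = 1 ∧ (u - v).arg = (v - u).arg + Real.pi) := by
  have h2 : u - v = -(v - u) := by ring
  have h' : ¬((v - u).re = 0 ∧ (v - u).im = 0) := fun h0 =>
    h (sub_eq_zero.1 (Complex.ext h0.1 h0.2)).symm
  rw [planeSide, planeSide, h2, Complex.arg_neg_eq_arg_sub_pi_iff,
    Complex.arg_neg_eq_arg_add_pi_iff, Complex.neg_re, Complex.neg_im]
  generalize (v - u).re = x at *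
  generalize (v - u).im = y at *
  rcases lt_trichotomy y 0 with hy | rfl | hy
  · simp [hy, hy.ne, hy.not_gt]
  · rcases lt_trichotomy x 0 with hx | rfl | hx
    · simp [hx, hx.not_gt]
    · simp at h'
    · simp [hx, hx.not_gt]
  · simp [hy, hy.ne', hy.not_gt]

theorem log_sub_log_swap {u v : ℂ} (h : u ≠ v) :
    Complex.log (v - u) - Complex.log (u - v) =
      (planeSide u v - 1 / 2) * (2 * Real.pi * Complex.I) := by
  have hn : ‖v - u‖ = ‖u - v‖ := norm_sub_rev _ _
  rw [Complex.log, Complex.log, hn]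
  rcases planeSide_cases h with ⟨h1, -, h3⟩ | ⟨h1, -, h3⟩ <;> rw [h1, h3] <;> push_cast <;> ring

/-- The winding number of the difference of two disjoint paths around the boundary of the square
vanishes. -/
theorem turns_eq_zero_of_disjoint {α β : ℝ → ℂ} (hα : Continuous α) (hβ : Continuous β)
    (hd : ∀ s t, α s ≠ β t) {ka kb kc kd : ℤ}
    (ha : ∀ (c : ℂ) (g : ℝ → ℂ), Continuous g → (∀ t, Complex.exp (g t) = c * (β t - α 0)) →
      g 1 - g 0 = Complex.log (β 1 - α 0) - Complex.log (β 0 - α 0) +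
        ka * (2 * Real.pi * Complex.I))
    (hb : ∀ (c : ℂ) (g : ℝ → ℂ), Continuous g → (∀ t, Complex.exp (g t) = c * (β t - α 1)) →
      g 1 - g 0 = Complex.log (β 1 - α 1) - Complex.log (β 0 - α 1) +
        kb * (2 * Real.pi * Complex.I))
    (hc : ∀ (c : ℂ) (g : ℝ → ℂ), Continuous g → (∀ t, Complex.exp (g t) = c * (α t - β 0)) →
      g 1 - g 0 = Complex.log (α 1 - β 0) - Complex.log (α 0 - β 0) +
        kc * (2 * Real.pi * Complex.I))
    (hd' : ∀ (c : ℂ) (g : ℝ → ℂ), Continuous g → (∀ t, Complex.exp (g t) = c * (α t - β 1)) →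
      g 1 - g 0 = Complex.log (α 1 - β 1) - Complex.log (α 0 - β 1) +
        kd * (2 * Real.pi * Complex.I)) :
    planeSide (α 1) (β 1) - planeSide (α 0) (β 1) - planeSide (α 1) (β 0) + planeSide (α 0) (β 0)
      + kb - ka + kc - kd = 0 := by
  obtain ⟨L, hL, hexp⟩ := exists_continuous_log (A := ℝ × ℝ) (f := fun p => α p.1 - β p.2)
    (by fun_prop) (fun p => sub_ne_zero.2 (hd _ _))
  have h1 := ha (-1) (fun t => L (0, t)) (by fun_prop) (fun t => by rw [hexp]; ring)
  have h2 := hb (-1) (fun t => L (1, t)) (by fun_prop) (fun t => by rw [hexp]; ring)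
  have h3 := hc 1 (fun t => L (t, 0)) (by fun_prop) (fun t => by rw [hexp]; ring)
  have h4 := hd' 1 (fun t => L (t, 1)) (by fun_prop) (fun t => by rw [hexp]; ring)
  have e00 := log_sub_log_swap (hd 0 0)
  have e01 := log_sub_log_swap (hd 0 1)
  have e10 := log_sub_log_swap (hd 1 0)
  have e11 := log_sub_log_swap (hd 1 1)
  have hpi : (2 * Real.pi * Complex.I : ℂ) ≠ 0 := Complex.two_pi_I_ne_zero
  have key : ((planeSide (α 1) (β 1) - planeSide (α 0) (β 1) - planeSide (α 1) (β 0) +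
      planeSide (α 0) (β 0) + kb - ka + kc - kd : ℤ) : ℂ) * (2 * Real.pi * Complex.I) = 0 := by
    push_cast
    linear_combination h1 - h2 - h3 + h4 - e11 + e01 + e10 - e00
  exact_mod_cast (mul_eq_zero.1 key).resolve_right hpi
/-! ### Parity drawings -/

/-- A multigraph given by the two ends of each edge. -/
structure Incidence (V E : Type*) where
  tl : E → V
  hd : E → V

/-- The data that determines the intersection numbers modulo two of vertex-disjoint edges in a
drawing: the relative positions of the vertices, and how edges wind around vertices. -/
structure ParityDrawing (V E : Type*) where
  side : V → V → ZMod 2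
  side_add_swap : ∀ u v, u ≠ v → side u v + side v u = 1
  wind : V → E → ZMod 2

namespace Incidence

variable {V E V' E' : Type*} (G : Incidence V E) (P : ParityDrawing V E)

/-- Two edges without a common end. -/
def Indep (e f : E) : Prop :=
  G.tl e ≠ G.tl f ∧ G.tl e ≠ G.hd f ∧ G.hd e ≠ G.tl f ∧ G.hd e ≠ G.hd f

instance [DecidableEq V] (e f : E) : Decidable (G.Indep e f) := by
  unfold Indep; infer_instance

variable {G} in
theorem Indep.symm {e f : E} (h : G.Indep e f) : G.Indep f e :=
  ⟨h.1.symm, h.2.2.1.symm, h.2.1.symm, h.2.2.2.symm⟩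

/-- The intersection number modulo two of a pair of edges (meaningful for independent edges). -/
def cross (e f : E) : ZMod 2 :=
  P.side (G.tl e) (G.tl f) + P.side (G.tl e) (G.hd f) + P.side (G.hd e) (G.tl f) +
    P.side (G.hd e) (G.hd f) + P.wind (G.tl e) f + P.wind (G.hd e) f + P.wind (G.tl f) e +
    P.wind (G.hd f) e

variable {G} in
theorem cross_comm {e f : E} (h : G.Indep e f) : G.cross P e f = G.cross P f e := by
  obtain ⟨h1, h2, h3, h4⟩ := h
  have s1 := P.side_add_swap _ _ h1
  have s2 := P.side_add_swap _ _ h2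
  have s3 := P.side_add_swap _ _ h3
  have s4 := P.side_add_swap _ _ h4
  unfold cross
  linear_combination s1 + s2 + s3 + s4 - CharTwo.add_self_eq_zero (R := ZMod 2)
    (P.side (G.tl f) (G.tl e) + P.side (G.hd f) (G.tl e) + P.side (G.tl f) (G.hd e)
      + P.side (G.hd f) (G.hd e)) + 2 * CharTwo.two_eq_zero (R := ZMod 2)

/-- The ordered pairs of independent edges that cross an odd number of times. -/
def oddPairs [Fintype E] [DecidableEq V] : Finset (E × E) :=
  {p | G.Indep p.1 p.2 ∧ G.cross P p.1 p.2 ≠ 0}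

@[simp] theorem mem_oddPairs [Fintype E] [DecidableEq V] {e f : E} :
    (e, f) ∈ G.oddPairs P ↔ G.Indep e f ∧ G.cross P e f ≠ 0 := by
  simp [oddPairs]

theorem swap_mem_oddPairs [Fintype E] [DecidableEq V] {e f : E}
    (h : (e, f) ∈ G.oddPairs P) : (f, e) ∈ G.oddPairs P := by
  rw [mem_oddPairs] at h ⊢
  exact ⟨h.1.symm, cross_comm P h.1 ▸ h.2⟩

/-- The boundary modulo two of the set of edges `α` is `u + v`. -/
def HasEnds (α : Finset E) (u v : V) : Prop :=
  ∀ g : V → ZMod 2, ∑ e ∈ α, (g (G.tl e) + g (G.hd e)) = g u + g v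

theorem hasEnds_singleton (e : E) : G.HasEnds {e} (G.tl e) (G.hd e) := fun g => by simp

variable {G} in
theorem HasEnds.symm {α : Finset E} {u v : V} (h : G.HasEnds α u v) : G.HasEnds α v u :=
  fun g => (h g).trans (add_comm _ _)

variable {G} in
theorem sum_cross {α β : Finset E} {a b c d : V} (hα : G.HasEnds α a b) (hβ : G.HasEnds β c d) :
    ∑ e ∈ α, ∑ f ∈ β, G.cross P e f = P.side a c + P.side a d + P.side b c + P.side b d +
      ∑ f ∈ β, P.wind a f + ∑ f ∈ β, P.wind b f + ∑ e ∈ α, P.wind c e + ∑ e ∈ α, P.wind d e := by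
  have h1 : ∀ e, ∑ f ∈ β, G.cross P e f = (P.side (G.tl e) c + P.side (G.hd e) c) +
      (P.side (G.tl e) d + P.side (G.hd e) d) +
      (∑ f ∈ β, P.wind (G.tl e) f + ∑ f ∈ β, P.wind (G.hd e) f) + (P.wind c e + P.wind d e) := by
    intro e
    have e1 := hβ (P.side (G.tl e))
    have e2 := hβ (P.side (G.hd e))
    have e3 := hβ (fun v => P.wind v e)
    simp only [cross, Finset.sum_add_distrib] at e1 e2 e3 ⊢
    linear_combination e1 + e2 + e3
  simp only [h1]
  have e1 := hα (fun v => P.side v c)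
  have e2 := hα (fun v => P.side v d)
  have e3 := hα (fun v => ∑ f ∈ β, P.wind v f)
  simp only [Finset.sum_add_distrib] at e1 e2 e3 ⊢
  linear_combination e1 + e2 + e3

variable {G} in
theorem sum_cross_closed {α β : Finset E} {a c : V} (hα : G.HasEnds α a a)
    (hβ : G.HasEnds β c c) : ∑ e ∈ α, ∑ f ∈ β, G.cross P e f = 0 := by
  rw [sum_cross P hα hβ]
  linear_combination CharTwo.add_self_eq_zero (P.side a c) + CharTwo.add_self_eq_zero (P.side a c) +
    CharTwo.add_self_eq_zero (∑ f ∈ β, P.wind a f) + CharTwo.add_self_eq_zero (∑ e ∈ α, P.wind c e)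

end Incidence

/-- The parity drawing of a multigraph whose edges are drawn as chains of edges of another one. -/
def ParityDrawing.pull {V E V' E' : Type*} (P : ParityDrawing V E) (ι : V' ↪ V)
    (c : E' → Finset E) : ParityDrawing V' E' where
  side u v := P.side (ι u) (ι v)
  side_add_swap _ _ h := P.side_add_swap _ _ (ι.injective.ne h)
  wind v e := ∑ x ∈ c e, P.wind (ι v) x

theorem Incidence.cross_pull {V E V' E' : Type*} {G : Incidence V E} {G' : Incidence V' E'}
    (P : ParityDrawing V E) (ι : V' ↪ V) (c : E' → Finset E)
    (hc : ∀ e, G.HasEnds (c e) (ι (G'.tl e)) (ι (G'.hd e))) (e f : E') :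
    G'.cross (P.pull ι c) e f = ∑ x ∈ c e, ∑ y ∈ c f, G.cross P x y := by
  rw [sum_cross P (hc e) (hc f)]
  rfl

/-! ### The parity drawing of a drawing -/

namespace Drawing

variable {V : Type*} {G : SimpleGraph V} (D : Drawing G)

/-- The position of a vertex as a complex number. -/
noncomputable def point (v : V) : ℂ := Complex.equivRealProdCLM.symm (D.vertexMap v)

/-- The arc of an edge as a path in `ℂ` defined on the whole real line. -/
noncomputable def path (e : G.edgeSet) (t : ℝ) : ℂ :=
  Complex.equivRealProdCLM.symm (D.arc e (Set.projIcc (0 : ℝ) 1 zero_le_one t))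

theorem continuous_path (e : G.edgeSet) : Continuous (D.path e) :=
  Complex.equivRealProdCLM.symm.continuous.comp
    ((continuousOn_iff_continuous_domRestrict.1 (D.arc_continuousOn e)).comp continuous_projIcc)

theorem point_ne {u v : V} (h : u ≠ v) : D.point u ≠ D.point v := fun h' =>
  h (D.vertexMap_injective (Complex.equivRealProdCLM.symm.injective h'))

theorem exists_incidence : ∃ I : Incidence V G.edgeSet, ∀ e : G.edgeSet,
    (e : Sym2 V) = s(I.tl e, I.hd e) ∧ D.arc e 0 = D.vertexMap (I.tl e) ∧
      D.arc e 1 = D.vertexMap (I.hd e) := by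
  choose t h H using D.arc_endpoints
  exact ⟨⟨t, h⟩, H⟩

theorem exists_parityDrawing : ∃ (I : Incidence V G.edgeSet) (P : ParityDrawing V G.edgeSet),
    (∀ e : G.edgeSet, (e : Sym2 V) = s(I.tl e, I.hd e)) ∧
      ∀ e f, I.Indep e f → I.cross P e f ≠ 0 → ∃ p, (s(e, f), p) ∈ D.crossings := by
  obtain ⟨I, hI⟩ := D.exists_incidence
  have p0 : ∀ e, D.path e 0 = D.point (I.tl e) := fun e => by
    rw [path, Set.projIcc_left, point, (hI e).2.1]
  have p1 : ∀ e, D.path e 1 = D.point (I.hd e) := fun e => by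
    rw [path, Set.projIcc_right, point, (hI e).2.2]
  have cases : ∀ e t, D.path e t = D.point (I.tl e) ∨ D.path e t = D.point (I.hd e) ∨
      ∃ t' ∈ Set.Ioo (0 : ℝ) 1, D.path e t = Complex.equivRealProdCLM.symm (D.arc e t') := by
    intro e t
    obtain ⟨t', ht⟩ : ∃ t', t' = Set.projIcc (0 : ℝ) 1 zero_le_one t := ⟨_, rfl⟩
    rcases t'.2.1.eq_or_lt with h | h
    · left; rw [← p0, path, path, ← ht, ← h, Set.projIcc_left]
    · rcases t'.2.2.eq_or_lt with h' | h'
      · right; left; rw [← p1, path, path, ← ht, h', Set.projIcc_right]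
      · exact .inr (.inr ⟨t', ⟨h, h'⟩, by rw [path, ← ht]⟩)
  have avoid : ∀ e v, v ≠ I.tl e → v ≠ I.hd e → ∀ t, D.path e t ≠ D.point v := by
    intro e v h h' t
    rcases cases e t with h1 | h1 | ⟨t', h1, h2⟩
    · exact h1 ▸ D.point_ne h.symm
    · exact h1 ▸ D.point_ne h'.symm
    · exact fun H => D.arc_avoids_vertices e t' h1 v
        (Complex.equivRealProdCLM.symm.injective (h2.symm.trans H))
  have turns : ∀ v e, ∃ k : ℤ, v ≠ I.tl e → v ≠ I.hd e → ∀ (c : ℂ) (g : ℝ → ℂ), Continuous g →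
      (∀ t, Complex.exp (g t) = c * (D.path e t - D.point v)) →
      g 1 - g 0 = Complex.log (D.path e 1 - D.point v) - Complex.log (D.path e 0 - D.point v) +
        k * (2 * Real.pi * Complex.I) := by
    intro v e
    by_cases h : v ≠ I.tl e ∧ v ≠ I.hd e
    · obtain ⟨k, hk⟩ := exists_turns (D.continuous_path e) (avoid e v h.1 h.2)
      exact ⟨k, fun _ _ => hk⟩
    · exact ⟨0, fun h1 h2 => (h ⟨h1, h2⟩).elim⟩
  choose k hk using turns
  refine ⟨I, ⟨fun u v => planeSide (D.point u) (D.point v), fun u v h => ?_, fun v e => k v e⟩,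
    fun e => (hI e).1, fun e f hef => ?_⟩
  · rcases planeSide_cases (D.point_ne h) with ⟨h1, h2, -⟩ | ⟨h1, h2, -⟩ <;> simp [h1, h2]
  contrapose!
  intro hno
  obtain ⟨h1, h2, h3, h4⟩ := hef
  have hne : e ≠ f := fun h => h1 (by rw [h])
  have hdisj : ∀ s t, D.path e s ≠ D.path f t := by
    intro s t
    rcases cases e s with H | H | ⟨s', hs, H⟩
    · exact H ▸ (avoid f _ h1 h2 t).symm
    · exact H ▸ (avoid f _ h3 h4 t).symm
    rcases cases f t with H' | H' | ⟨t', ht, H'⟩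
    · exact H' ▸ avoid e _ h1.symm h3.symm s
    · exact H' ▸ avoid e _ h2.symm h4.symm s
    · intro h
      rw [H, H'] at h
      exact hno (D.arc e s') ⟨e, f, hne, rfl, ⟨s', hs, rfl⟩, t', ht,
        (Complex.equivRealProdCLM.symm.injective h).symm⟩
  have key := turns_eq_zero_of_disjoint (D.continuous_path e) (D.continuous_path f) hdisj
    (ka := k (I.tl e) f) (kb := k (I.hd e) f) (kc := k (I.tl f) e) (kd := k (I.hd f) e)
    (by rw [p0 e]; exact hk _ _ h1 h2) (by rw [p1 e]; exact hk _ _ h3 h4)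
    (by rw [p0 f]; exact hk _ _ h1.symm h3.symm) (by rw [p1 f]; exact hk _ _ h2.symm h4.symm)
  rw [p0, p0, p1, p1] at key
  have key2 := congrArg (Int.cast : ℤ → ZMod 2) key
  push_cast at key2
  simp only [CharTwo.sub_eq_add] at key2
  simp only [Incidence.cross]
  rw [← key2]
  ring

end Drawing

/-! ### Certificates -/

namespace ParityDrawing

section Mask

variable (P : ParityDrawing ℕ ℕ)

/-- The variables of which intersection numbers are affine functions, numbered; the number `0`
stands for the constant. -/
def value (k : ℕ) : ZMod 2 :=
  if k = 0 then 1
  else if k % 2 = 1 then P.side (k / 2).unpair.1 (k / 2).unpair.2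
  else P.wind (k / 2 - 1).unpair.1 (k / 2 - 1).unpair.2

/-- The value of a sum of variables that is encoded by the binary digits of `x`. -/
noncomputable def evalMask (x : ℕ) : ZMod 2 :=
  ∑ᶠ k, if x.testBit k then P.value k else 0

/-- The encoding of `P.side u v`, where `P.side u v` for `v < u` is replaced by
`1 + P.side v u`. -/
def sideMask (u v : ℕ) : ℕ :=
  if u < v then 2 ^ (2 * Nat.pair u v + 1) else 2 ^ (2 * Nat.pair v u + 1) ^^^ 1

/-- The encoding of `P.wind v e`. -/
def windMask (v e : ℕ) : ℕ :=
  2 ^ (2 * Nat.pair v e + 2)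

theorem finite_support_evalMask (x : ℕ) :
    (Function.support fun k => if x.testBit k then P.value k else 0).Finite := by
  refine (Finset.range x).finite_toSet.subset fun k hk => ?_
  have hk' : x.testBit k := by
    by_contra h
    simp [h] at hk
  simpa using k.lt_two_pow_self.trans_le (Nat.ge_two_pow_of_testBit hk')

theorem evalMask_xor (x y : ℕ) : P.evalMask (x ^^^ y) = P.evalMask x + P.evalMask y := by
  unfold evalMask
  rw [← finsum_add_distrib (P.finite_support_evalMask x) (P.finite_support_evalMask y)]
  refine finsum_congr fun m => ?_
  rw [Nat.testBit_xor]
  cases x.testBit m <;> cases y.testBit m <;> simp [CharTwo.add_self_eq_zero]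

theorem evalMask_two_pow (k : ℕ) : P.evalMask (2 ^ k) = P.value k := by
  unfold evalMask
  rw [finsum_eq_single _ k fun j hj => by simp [hj.symm]]
  simp

theorem evalMask_zero : P.evalMask 0 = 0 := by simp [evalMask]

theorem evalMask_one : P.evalMask 1 = 1 :=
  P.evalMask_two_pow 0

theorem evalMask_sideMask {u v : ℕ} (h : u ≠ v) : P.evalMask (sideMask u v) = P.side u v := by
  have key (u v : ℕ) : P.evalMask (2 ^ (2 * Nat.pair u v + 1)) = P.side u v := by
    rw [evalMask_two_pow, value, if_neg (by omega), if_pos (by omega),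
      show (2 * Nat.pair u v + 1) / 2 = Nat.pair u v by omega, Nat.unpair_pair]
  unfold sideMask
  split
  · exact key u v
  · rw [evalMask_xor, evalMask_one, key, ← P.side_add_swap u v h]
    linear_combination CharTwo.add_self_eq_zero (P.side v u)

theorem evalMask_windMask (v e : ℕ) : P.evalMask (windMask v e) = P.wind v e := by
  rw [windMask, evalMask_two_pow, value, if_neg (by omega), if_neg (by omega),
    show (2 * Nat.pair v e + 2) / 2 - 1 = Nat.pair v e by omega, Nat.unpair_pair]

end Mask

end ParityDrawing

namespace Incidence

open ParityDrawing

section Words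

variable (H : Incidence ℕ ℕ)

/-- The encoding of `H.cross P e f`. -/
def crossMask (e f : ℕ) : ℕ :=
  sideMask (H.tl e) (H.tl f) ^^^ sideMask (H.tl e) (H.hd f) ^^^
    sideMask (H.hd e) (H.tl f) ^^^ sideMask (H.hd e) (H.hd f) ^^^ windMask (H.tl e) f ^^^
    windMask (H.hd e) f ^^^ windMask (H.tl f) e ^^^ windMask (H.hd f) e

variable {H} in
theorem evalMask_crossMask {e f : ℕ} (P : ParityDrawing ℕ ℕ) (h : H.Indep e f) :
    P.evalMask (H.crossMask e f) = H.cross P e f := by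
  simp only [crossMask, evalMask_xor, cross, evalMask_sideMask P h.1, evalMask_sideMask P h.2.1,
    evalMask_sideMask P h.2.2.1, evalMask_sideMask P h.2.2.2, evalMask_windMask]

/-- A list of pairs of independent edges whose intersection numbers always add up to `1`. -/
def IsOddWord (w : List (ℕ × ℕ)) : Prop :=
  (∀ p ∈ w, H.Indep p.1 p.2) ∧ w.foldr (fun p x => H.crossMask p.1 p.2 ^^^ x) 0 = 1

instance (w : List (ℕ × ℕ)) : Decidable (H.IsOddWord w) := by
  unfold IsOddWord; infer_instance

variable {H} in
theorem IsOddWord.exists_mem {w : List (ℕ × ℕ)} (h : H.IsOddWord w) (P : ParityDrawing ℕ ℕ) :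
    ∃ p ∈ w, H.cross P p.1 p.2 ≠ 0 := by
  obtain ⟨hi, hw⟩ := h
  by_contra! h0
  have key : P.evalMask (w.foldr (fun p x => H.crossMask p.1 p.2 ^^^ x) 0) = 0 := by
    clear hw
    induction w with
    | nil => exact P.evalMask_zero
    | cons p w ih =>
      rw [List.foldr_cons, evalMask_xor, evalMask_crossMask P (hi p (by simp)),
        h0 p (by simp), zero_add]
      exact ih (fun q hq => hi q (by simp [hq])) fun q hq => h0 q (by simp [hq])
  rw [hw, evalMask_one] at key
  exact one_ne_zero key

/-- The encoding of the set of all pairs that occur in a list, in one order or the other. -/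
def wordMask (w : List (ℕ × ℕ)) : ℕ :=
  w.foldr (fun p x => 2 ^ Nat.pair p.1 p.2 ||| (2 ^ Nat.pair p.2 p.1 ||| x)) 0

theorem testBit_wordMask {w : List (ℕ × ℕ)} {p : ℕ × ℕ} (hp : p ∈ w) :
    (wordMask w).testBit (Nat.pair p.1 p.2) ∧ (wordMask w).testBit (Nat.pair p.2 p.1) := by
  induction w with
  | nil => simp at hp
  | cons q w ih =>
    simp only [wordMask, List.foldr_cons, Nat.testBit_or, Nat.testBit_two_pow, Bool.or_eq_true,
      decide_eq_true_eq]
    rcases List.mem_cons.1 hp with rfl | hp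
    · simp
    · exact ⟨.inr (.inr (ih hp).1), .inr (.inr (ih hp).2)⟩

/-- The sets of elements that are covered by at least one, two or three of the sets that are
encoded by the elements of a list. -/
def coverMasks (l : List ℕ) : ℕ × ℕ × ℕ :=
  l.foldr (fun x s => (s.1 ||| x, s.2.1 ||| (s.1 &&& x), s.2.2 ||| (s.2.1 &&& x))) (0, 0, 0)

theorem testBit_coverMasks (l : List ℕ) (k : ℕ) :
    (0 < l.countP (·.testBit k) → (coverMasks l).1.testBit k) ∧
      (1 < l.countP (·.testBit k) → (coverMasks l).2.1.testBit k) ∧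
      (2 < l.countP (·.testBit k) → (coverMasks l).2.2.testBit k) := by
  induction l with
  | nil => simp
  | cons x l ih =>
    obtain ⟨h1, h2, h3⟩ := ih
    simp only [coverMasks, List.foldr_cons, Nat.testBit_or, Nat.testBit_and, List.countP_cons] at *
    by_cases hx : x.testBit k
    · simp only [hx, if_true]
      refine ⟨fun _ => by simp, fun h => ?_, fun h => ?_⟩
      · simp [h1 (by omega)]
      · simp [h2 (by omega)]
    · simp only [hx]
      exact ⟨fun h => by simp [h1 (by simpa using h)], fun h => by simp [h2 (by simpa using h)],
        fun h => by simp [h3 (by simpa using h)]⟩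

end Words

/-- If every pair of edges occurs in at most two of the words `W`, then there are at least `#W`
odd pairs. -/
theorem length_le_card_oddPairs {V E : Type*} [Fintype E] [DecidableEq V] {G : Incidence V E}
    (P : ParityDrawing V E) {H : Incidence ℕ ℕ} {cv : V → ℕ} {dv : ℕ → V} {ce : E → ℕ}
    {de : ℕ → E} (hv : Function.LeftInverse dv cv) (he : Function.LeftInverse de ce)
    (htl : ∀ e, H.tl (ce e) = cv (G.tl e)) (hhd : ∀ e, H.hd (ce e) = cv (G.hd e))
    (W : List (List (ℕ × ℕ))) (hW : ∀ w ∈ W, H.IsOddWord w)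
    (hr : ∀ w ∈ W, ∀ p ∈ w, ce (de p.1) = p.1 ∧ ce (de p.2) = p.2)
    (hc : (coverMasks (W.map wordMask)).2.2 = 0) : W.length ≤ (G.oddPairs P).card := by
  let P' : ParityDrawing ℕ ℕ :=
    { side := fun u v => if cv (dv u) = u ∧ cv (dv v) = v then P.side (dv u) (dv v)
        else if u < v then 1 else 0
      side_add_swap := fun u v h => by
        by_cases h' : cv (dv u) = u ∧ cv (dv v) = v
        · rw [if_pos h', if_pos h'.symm]
          exact P.side_add_swap _ _ fun h'' => h (by rw [← h'.1, ← h'.2, h''])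
        · have h'' : ¬(cv (dv v) = v ∧ cv (dv u) = u) := fun h => h' h.symm
          rcases h.lt_or_gt with h | h <;> simp [h', h'', h, h.not_gt]
      wind := fun v e => P.wind (dv v) (de e) }
  have hcross (e f : E) : H.cross P' (ce e) (ce f) = G.cross P e f := by
    simp only [cross, htl, hhd, P', hv _, he _, true_and, if_true]
  have hindep (e f : E) (h : H.Indep (ce e) (ce f)) : G.Indep e f := by
    simp only [Indep, htl, hhd] at h
    exact ⟨fun h' => h.1 (by rw [h']), fun h' => h.2.1 (by rw [h']),
      fun h' => h.2.2.1 (by rw [h']), fun h' => h.2.2.2 (by rw [h'])⟩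
  have h1 : W.length * 2 ≤ ∑ p ∈ G.oddPairs P,
      (W.map wordMask).countP (·.testBit (Nat.pair (ce p.1) (ce p.2))) := by
    clear hc
    induction W with
    | nil => simp
    | cons w W ih =>
      obtain ⟨⟨e, f⟩, hp, h0⟩ := (hW w (by simp)).exists_mem P'
      obtain ⟨h1, h2⟩ := hr w (by simp) _ hp
      generalize de e = e at h1
      generalize de f = f at h2
      dsimp only at h1 h2
      subst h1 h2
      have hm : (e, f) ∈ G.oddPairs P :=
        (G.mem_oddPairs P).2 ⟨hindep _ _ ((hW w (by simp)).1 _ hp), hcross e f ▸ h0⟩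
      have hm' := G.swap_mem_oddPairs P hm
      have hne : (e, f) ≠ (f, e) := by
        intro h
        have := ((G.mem_oddPairs P).1 hm).1.1
        rw [(Prod.mk.inj h).1] at this
        exact this rfl
      have h2 : 2 ≤ ∑ p ∈ G.oddPairs P,
          if (wordMask w).testBit (Nat.pair (ce p.1) (ce p.2)) then 1 else 0 := by
        classical
        rw [← Finset.card_filter, ← Finset.card_pair hne]
        refine Finset.card_le_card fun q hq => ?_
        simp only [Finset.mem_insert, Finset.mem_singleton] at hq
        rcases hq with rfl | rfl
        · exact Finset.mem_filter.2 ⟨hm, (testBit_wordMask hp).1⟩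
        · exact Finset.mem_filter.2 ⟨hm', (testBit_wordMask hp).2⟩
      have h3 := ih (fun w hw => hW w (by simp [hw])) fun w hw => hr w (by simp [hw])
      simp only [List.map_cons, List.countP_cons, Finset.sum_add_distrib, List.length_cons]
      omega
  have h2 := h1.trans (Finset.sum_le_card_nsmul _ _ 2 fun p _ => by
    by_contra! h
    have := (testBit_coverMasks _ _).2.2 h
    rw [hc] at this
    simp at this)
  rw [smul_eq_mul] at h2
  omega

end Incidence

/-! ### Odd pairs and pulling back -/

namespace Incidence

section Pull

variable {V E V' E' : Type*} [Fintype E] [Fintype E'] [DecidableEq V] [DecidableEq V']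
  {G : Incidence V E} {G' : Incidence V' E'} (P : ParityDrawing V E) (ι : V' ↪ V)

theorem exists_mem_oddPairs_of_pull {c : E' → Finset E}
    (hc : ∀ e, G.HasEnds (c e) (ι (G'.tl e)) (ι (G'.hd e)))
    (hi : ∀ e f, G'.Indep e f → ∀ x ∈ c e, ∀ y ∈ c f, G.Indep x y) {e f : E'}
    (h : (e, f) ∈ G'.oddPairs (P.pull ι c)) : ∃ x ∈ c e, ∃ y ∈ c f, (x, y) ∈ G.oddPairs P := by
  rw [mem_oddPairs, cross_pull P ι c hc] at h
  obtain ⟨x, hx, h0⟩ := Finset.exists_ne_zero_of_sum_ne_zero h.2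
  obtain ⟨y, hy, h0⟩ := Finset.exists_ne_zero_of_sum_ne_zero h0
  exact ⟨x, hx, y, hy, (G.mem_oddPairs P).2 ⟨hi e f h.1 x hx y hy, h0⟩⟩

variable {ι} {κ : E' → E}

theorem mem_oddPairs_pull_singleton
    (hκ : ∀ e, s(G.tl (κ e), G.hd (κ e)) = s(ι (G'.tl e), ι (G'.hd e))) {e f : E'} :
    (e, f) ∈ G'.oddPairs (P.pull ι fun e => {κ e}) ↔ (κ e, κ f) ∈ G.oddPairs P := by
  have hc (e : E') : G.HasEnds {κ e} (ι (G'.tl e)) (ι (G'.hd e)) := by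
    rcases Sym2.eq_iff.1 (hκ e) with h | h
    · exact h.1 ▸ h.2 ▸ G.hasEnds_singleton (κ e)
    · exact h.1 ▸ h.2 ▸ (G.hasEnds_singleton (κ e)).symm
  rw [mem_oddPairs, mem_oddPairs, cross_pull P ι _ hc]
  simp only [Finset.sum_singleton]
  refine and_congr_left fun _ => ?_
  have hi := ι.injective
  rcases Sym2.eq_iff.1 (hκ e) with ⟨h1, h2⟩ | ⟨h1, h2⟩ <;>
    rcases Sym2.eq_iff.1 (hκ f) with ⟨h3, h4⟩ | ⟨h3, h4⟩ <;>
    simp only [Indep, h1, h2, h3, h4, ne_eq, hi.eq_iff] <;> tauto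

theorem card_oddPairs_pull_singleton_le
    (hκ : ∀ e, s(G.tl (κ e), G.hd (κ e)) = s(ι (G'.tl e), ι (G'.hd e)))
    (hinj : Function.Injective κ) :
    (G'.oddPairs (P.pull ι fun e => {κ e})).card ≤ (G.oddPairs P).card :=
  Finset.card_le_card_of_injOn (Prod.map κ κ)
    (fun _ hp => (mem_oddPairs_pull_singleton P hκ).1 hp) (hinj.prodMap hinj).injOn

end Pull

end Incidence

/-! ### The complete graph on six vertices without an edge -/

/-- The first end of an edge of the diamond. -/
def diamondTl : Fin 5 → Fin 4 := ![0, 0, 1, 1, 2]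

/-- The second end of an edge of the diamond. -/
def diamondHd : Fin 5 → Fin 4 := ![1, 2, 2, 3, 3]

/-- The join of a diamond with an edge; its two other vertices are the poles, and the edge that
joins the poles is `none`. -/
def joinGraph : Incidence (Fin 4 ⊕ Bool) (Fin 5 ⊕ Option (Bool × Fin 4)) where
  tl := Sum.elim (fun j => .inl (diamondTl j)) fun o => .inr (o.elim false Prod.fst)
  hd := Sum.elim (fun j => .inl (diamondHd j)) fun o => o.elim (.inr true) fun p => .inl p.2

/-- Odd words of the join. -/
def joinWords : List (List (ℕ × ℕ)) :=
  [[(0,7),(0,11),(0,13),(1,6),(1,10),(1,13),(2,5),(2,9),(2,13),(5,10),(5,11),(6,9),(6,11),(7,9),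
    (7,10)],
   [(0,8),(0,12),(0,13),(1,6),(1,10),(1,13),(3,5),(3,9),(3,13),(4,6),(4,10),(4,13),(5,10),(5,12),
    (6,9),(6,12),(8,9),(8,10)],
   [(0,4),(0,7),(0,8),(2,5),(2,8),(2,9),(2,12),(3,5),(3,7),(3,9),(3,11),(4,5),(4,6),(6,11),(6,12),
    (7,9),(7,12),(8,9),(8,11)],
   [(0,4),(0,11),(0,12),(2,8),(2,12),(2,13),(3,7),(3,11),(3,13),(4,5),(4,10),(4,13),(5,11),(5,12),
    (7,10),(7,12),(8,10),(8,11)]]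

theorem four_le_card_oddPairs_joinGraph (P) : 4 ≤ (joinGraph.oddPairs P).card :=
  Incidence.length_le_card_oddPairs P
    (H := ⟨fun e => [0, 0, 1, 1, 2, 4, 4, 4, 4, 5, 5, 5, 5, 4].getD e 0,
      fun e => [1, 2, 2, 3, 3, 0, 1, 2, 3, 0, 1, 2, 3, 5].getD e 0⟩)
    (cv := Sum.elim Fin.val fun b => cond b 5 4)
    (dv := fun v => if v < 4 then .inl (Fin.ofNat 4 v) else .inr (v = 5))
    (ce := Sum.elim Fin.val fun o => o.elim 13 fun p => cond p.1 9 5 + p.2)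
    (de := fun e => if e < 5 then .inl (Fin.ofNat 5 e) else if e < 13 then
      .inr (some (decide (9 ≤ e), Fin.ofNat 4 (e - 5))) else .inr none)
    (by unfold Function.LeftInverse; decide) (by unfold Function.LeftInverse; decide)
    (by decide) (by decide) joinWords (by decide +kernel) (by decide +kernel)
    (by decide +kernel)

/-! ### A ring of diamonds -/

/-- The first end of an edge between consecutive diamonds; the edges with number less than `5` are
in the first diamond, the other ones are rails. -/
def ringTl : Fin 9 → Fin 4 := ![0, 0, 1, 1, 2, 0, 1, 2, 3]

/-- The second end of an edge between consecutive diamonds. -/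
def ringHd : Fin 9 → Fin 4 := ![1, 2, 2, 3, 3, 0, 1, 2, 3]

/-- The product of a diamond with a cycle of length `m + 1`. -/
def ring (m : ℕ) : Incidence (Fin 4 × Fin (m + 1)) (Fin 9 × Fin (m + 1)) where
  tl e := (ringTl e.1, e.2)
  hd e := (ringHd e.1, if e.1 < 5 then e.2 else e.2 + 1)

/-- Odd words of the ring of three diamonds, up to symmetry. -/
def ringWords : List (List (ℕ × ℕ)) :=
  [[(0,10),(0,14),(0,16),(0,18),(0,20),(1,8),(1,10),(1,13),(1,14),(1,18),(1,21),(1,26),(3,18),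
    (3,19),(3,20),(8,18),(8,20),(8,23),(8,25),(10,20),(10,24),(10,25),(13,18),(13,20),(13,23),
    (13,25),(14,20),(14,24),(14,25),(16,18),(16,23),(16,24),(18,25),(19,21),(19,24),(19,26),
    (20,23),(21,23),(21,25),(23,26),(25,26)],
   [(1,3),(1,20),(1,22),(1,24),(1,26),(3,5),(3,9),(3,12),(3,17),(3,22),(3,25),(4,12),(4,15),
    (4,17),(4,20),(4,22),(5,20),(5,22),(5,24),(5,26),(9,20),(9,22),(9,24),(9,26),(12,20),(12,24),
    (12,25),(15,22),(15,25),(15,26),(17,20),(17,24),(17,25),(20,26),(22,24),(24,25),(25,26)]]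

/-- Symmetries of the ring of three diamonds: the rotations, and those composed with the
exchange of the tips of all diamonds. -/
def ringSymmetries : List (ℕ → ℕ) :=
  [0, 9, 18].flatMap fun r => [fun e => (e + r) % 27,
    fun e => (e + r) / 9 % 3 * 9 + [3, 4, 2, 0, 1, 8, 6, 7, 5].getD (e % 9) 0]

/-- Odd words of the ring of three diamonds. -/
def ringAllWords : List (List (ℕ × ℕ)) :=
  ringWords.flatMap fun w => ringSymmetries.map fun s => w.map (Prod.map s s)

theorem twelve_le_card_oddPairs_ring_two (P) : 12 ≤ ((ring 2).oddPairs P).card :=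
  Incidence.length_le_card_oddPairs P
    (H := ⟨fun e => e / 9 * 4 + [0, 0, 1, 1, 2, 0, 1, 2, 3].getD (e % 9) 0,
      fun e => (e / 9 + if e % 9 < 5 then 0 else 1) % 3 * 4 +
        [1, 2, 2, 3, 3, 0, 1, 2, 3].getD (e % 9) 0⟩)
    (cv := fun v => v.2 * 4 + v.1) (dv := fun v => (Fin.ofNat 4 v, Fin.ofNat 3 (v / 4)))
    (ce := fun e => e.2 * 9 + e.1) (de := fun e => (Fin.ofNat 9 e, Fin.ofNat 3 (e / 9)))
    (by unfold Function.LeftInverse; decide) (by unfold Function.LeftInverse; decide)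
    (by decide) (by decide) ringAllWords (by decide +kernel) (by decide +kernel)
    (by decide +kernel)

/-! ### Removing a diamond from a ring -/

section Remove

variable {m : ℕ}

/-- The edges of the `i`-th diamond of a ring. -/
def InDiamond (i : Fin (m + 1)) (e : Fin 9 × Fin (m + 1)) : Prop := e.1 < 5 ∧ e.2 = i

instance (i : Fin (m + 1)) (e : Fin 9 × Fin (m + 1)) : Decidable (InDiamond i e) := by
  unfold InDiamond; infer_instance

/-- The odd pairs that involve the `i`-th diamond of a ring. -/
def diamondPairs (P : ParityDrawing (Fin 4 × Fin (m + 1)) (Fin 9 × Fin (m + 1))) (i : Fin (m + 1)) :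
    Finset ((Fin 9 × Fin (m + 1)) × (Fin 9 × Fin (m + 1))) :=
  {p ∈ (ring m).oddPairs P | InDiamond i p.1 ∨ InDiamond i p.2}

/-- The chain that represents an edge of a ring in the next larger ring. -/
def mergeChain (e : Fin 9 × Fin (m + 1)) : Finset (Fin 9 × Fin (m + 2)) :=
  if e.1 < 5 ∨ e.2 ≠ Fin.last m then {(e.1, e.2.castSucc)}
  else {(e.1, e.2.castSucc), (e.1, Fin.last (m + 1))}

theorem hasEnds_mergeChain (e : Fin 9 × Fin (m + 1)) :
    (ring (m + 1)).HasEnds (mergeChain e) (((ring m).tl e).1, ((ring m).tl e).2.castSucc)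
      (((ring m).hd e).1, ((ring m).hd e).2.castSucc) := by
  obtain ⟨j, i⟩ := e
  intro g
  by_cases hj : j < 5
  · simp [mergeChain, hj, ring]
  have hr : ringTl j = ringHd j := by
    revert j; decide
  by_cases hi : i = Fin.last m
  · subst hi
    have h0 : (Fin.last m).castSucc ≠ Fin.last (m + 1) := (Fin.castSucc_lt_last _).ne
    rw [mergeChain, if_neg (by simp [hj]), Finset.sum_pair (by simp [h0])]
    simp only [ring, hj, if_false, hr, Fin.last_add_one, Fin.castSucc_zero,
      show (Fin.last m).castSucc + 1 = Fin.last (m + 1) from by simp]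
    linear_combination CharTwo.add_self_eq_zero (g (ringHd j, Fin.last (m + 1)))
  · have h1 : (i + 1).castSucc = i.castSucc + 1 := by
      rw [Fin.ext_iff, Fin.val_castSucc, Fin.val_add_one_of_lt (Fin.lt_last_iff_ne_last.2 hi),
        Fin.val_add_one_of_lt (Fin.castSucc_lt_last i), Fin.val_castSucc]
    simp [mergeChain, hi, ring, hj, h1]

theorem eq_of_mem_mergeChain {e : Fin 9 × Fin (m + 1)} {x : Fin 9 × Fin (m + 2)}
    (h : x ∈ mergeChain e) : (x.1, (Fin.last m).predAbove x.2) = e := by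
  unfold mergeChain at h
  split at h
  · rw [Finset.mem_singleton] at h
    simp [h]
  · next he =>
    rw [Finset.mem_insert, Finset.mem_singleton] at h
    rcases h with rfl | rfl
    · simp
    · push Not at he
      ext1
      · simp
      · simp [he.2]

theorem not_inDiamond_of_mem_mergeChain {e : Fin 9 × Fin (m + 1)} {x : Fin 9 × Fin (m + 2)}
    (h : x ∈ mergeChain e) : ¬InDiamond (Fin.last (m + 1)) x := by
  rintro ⟨h1, h2⟩
  unfold mergeChain at h
  split at h
  · rw [Finset.mem_singleton] at h
    subst h
    exact (Fin.castSucc_lt_last _).ne h2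
  · next he =>
    push Not at he
    rw [Finset.mem_insert, Finset.mem_singleton] at h
    rcases h with rfl | rfl <;> exact (h1.trans_le he.1).false

theorem end_of_mem_mergeChain {e : Fin 9 × Fin (m + 1)} {x : Fin 9 × Fin (m + 2)}
    (h : x ∈ mergeChain e) {v : Fin 4 × Fin (m + 2)}
    (hv : v = (ring (m + 1)).tl x ∨ v = (ring (m + 1)).hd x) :
    (∃ u, (u = (ring m).tl e ∨ u = (ring m).hd e) ∧ v = (u.1, u.2.castSucc)) ∨
      v = (((ring m).tl e).1, Fin.last (m + 1)) ∧ ((ring m).tl e).2 = Fin.last m := by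
  obtain ⟨j, i⟩ := e
  by_cases hj : j < 5
  · rw [mergeChain, if_pos (.inl hj), Finset.mem_singleton] at h
    subst h
    left
    rcases hv with rfl | rfl
    · exact ⟨_, .inl rfl, rfl⟩
    · exact ⟨_, .inr rfl, by simp [ring, hj]⟩
  have hr : ringHd j = ringTl j := by
    clear h
    revert j; decide
  by_cases hi : i = Fin.last m
  · subst hi
    rw [mergeChain, if_neg (by simp [hj]), Finset.mem_insert, Finset.mem_singleton] at h
    rcases h with rfl | rfl <;> rcases hv with rfl | rfl
    · exact .inl ⟨_, .inl rfl, rfl⟩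
    · right
      simp [ring, hj, hr]
    · right
      simp [ring]
    · exact .inl ⟨_, .inr rfl, by simp [ring, hj]⟩
  · rw [mergeChain, if_pos (.inr hi), Finset.mem_singleton] at h
    subst h
    left
    have h1 : (i + 1).castSucc = i.castSucc + 1 := by
      rw [Fin.ext_iff, Fin.val_castSucc, Fin.val_add_one_of_lt (Fin.lt_last_iff_ne_last.2 hi),
        Fin.val_add_one_of_lt (Fin.castSucc_lt_last i), Fin.val_castSucc]
    rcases hv with rfl | rfl
    · exact ⟨_, .inl rfl, rfl⟩
    · exact ⟨_, .inr rfl, by simp [ring, hj, h1]⟩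

theorem indep_of_mem_mergeChain {e f : Fin 9 × Fin (m + 1)} (h : (ring m).Indep e f)
    {x y : Fin 9 × Fin (m + 2)} (hx : x ∈ mergeChain e) (hy : y ∈ mergeChain f) :
    (ring (m + 1)).Indep x y := by
  have key (v : Fin 4 × Fin (m + 2)) (hv : v = (ring (m + 1)).tl x ∨ v = (ring (m + 1)).hd x)
      (hv' : v = (ring (m + 1)).tl y ∨ v = (ring (m + 1)).hd y) : False := by
    rcases end_of_mem_mergeChain hx hv with ⟨u, hu, rfl⟩ | ⟨rfl, h1⟩ <;>
      rcases end_of_mem_mergeChain hy hv' with ⟨u', hu', h2⟩ | ⟨h2, h3⟩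
    · have huu : u = u' := Prod.ext (Prod.mk.inj h2).1
        (Fin.castSucc_injective _ (Prod.mk.inj h2).2)
      subst huu
      rcases hu with rfl | rfl <;> rcases hu' with hu' | hu'
      exacts [h.1 hu', h.2.1 hu', h.2.2.1 hu', h.2.2.2 hu']
    · exact (Fin.castSucc_lt_last _).ne (Prod.mk.inj h2).2
    · exact (Fin.castSucc_lt_last _).ne' (Prod.mk.inj h2).2
    · exact h.1 (Prod.ext (Prod.mk.inj h2).1 (h1.trans h3.symm))
  exact ⟨fun h => key _ (.inl rfl) (.inl h), fun h => key _ (.inl rfl) (.inr h),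
    fun h => key _ (.inr rfl) (.inl h), fun h => key _ (.inr rfl) (.inr h)⟩

theorem exists_card_oddPairs_add_le
    (P : ParityDrawing (Fin 4 × Fin (m + 2)) (Fin 9 × Fin (m + 2))) (i : Fin (m + 2)) :
    ∃ P', ((ring m).oddPairs P').card + (diamondPairs P i).card ≤
      ((ring (m + 1)).oddPairs P).card := by
  classical
  let r := i - Fin.last (m + 1)
  let ι : Fin 4 × Fin (m + 2) ↪ Fin 4 × Fin (m + 2) :=
    ⟨fun v => (v.1, v.2 + r), fun v w h => by simpa [Prod.ext_iff] using h⟩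
  let κ : Fin 9 × Fin (m + 2) → Fin 9 × Fin (m + 2) := fun e => (e.1, e.2 + r)
  have hinj : Function.Injective κ := fun v w h => by simpa [κ, Prod.ext_iff] using h
  have hκ (e) : s((ring (m + 1)).tl (κ e), (ring (m + 1)).hd (κ e)) =
      s(ι ((ring (m + 1)).tl e), ι ((ring (m + 1)).hd e)) := by
    have : (if e.1 < 5 then e.2 + r else e.2 + r + 1) =
      (if e.1 < 5 then e.2 else e.2 + 1) + r := by split <;> abel
    simp only [κ, ring, ι, this]
    rfl
  set Q := P.pull ι fun e => {κ e} with hQ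
  have hQP : ((ring (m + 1)).oddPairs Q).card ≤ ((ring (m + 1)).oddPairs P).card :=
    Incidence.card_oddPairs_pull_singleton_le P hκ hinj
  have hlast : (diamondPairs P i).card ≤ (diamondPairs Q (Fin.last (m + 1))).card := by
    refine Finset.card_le_card_of_surjOn (Prod.map κ κ) ?_
    rintro ⟨x, y⟩ hp
    have hs : Function.Surjective κ := Finite.surjective_of_injective hinj
    obtain ⟨x, rfl⟩ := hs x
    obtain ⟨y, rfl⟩ := hs y
    refine ⟨(x, y), ?_, rfl⟩
    simp only [diamondPairs, Finset.coe_filter, Set.mem_ofPred_eq] at hp ⊢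
    refine ⟨(Incidence.mem_oddPairs_pull_singleton P hκ).2 hp.1, ?_⟩
    have (x) (h : InDiamond i (κ x)) : InDiamond (Fin.last (m + 1)) x :=
      ⟨h.1, by simpa [κ, r, ← eq_sub_iff_add_eq] using h.2⟩
    exact hp.2.imp (this x) (this y)
  let ι' : Fin 4 × Fin (m + 1) ↪ Fin 4 × Fin (m + 2) :=
    ⟨fun v => (v.1, v.2.castSucc), fun v w h => by simpa [Prod.ext_iff] using h⟩
  refine ⟨Q.pull ι' mergeChain, le_trans ?_ hQP⟩
  rw [← Finset.card_filter_add_card_filter_not (s := (ring (m + 1)).oddPairs Q)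
    (fun p => InDiamond (Fin.last (m + 1)) p.1 ∨ InDiamond (Fin.last (m + 1)) p.2), add_comm]
  refine add_le_add hlast ?_
  let π : Fin 9 × Fin (m + 2) → Fin 9 × Fin (m + 1) := fun x => (x.1, (Fin.last m).predAbove x.2)
  refine Finset.card_le_card_of_surjOn (Prod.map π π) ?_
  rintro ⟨e, f⟩ hp
  obtain ⟨x, hx, y, hy, hxy⟩ := Incidence.exists_mem_oddPairs_of_pull Q ι'
    hasEnds_mergeChain (fun e f h x hx y hy => indep_of_mem_mergeChain h hx hy) hp
  refine ⟨(x, y), ?_, Prod.ext (eq_of_mem_mergeChain hx) (eq_of_mem_mergeChain hy)⟩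
  simp only [Finset.coe_filter, Set.mem_ofPred_eq]
  exact ⟨hxy, not_or.2 ⟨not_inDiamond_of_mem_mergeChain hx, not_inDiamond_of_mem_mergeChain hy⟩⟩

end Remove

/-! ### Rings in which every diamond is involved in at most one odd pair -/

section Good

variable {m : ℕ} {P : ParityDrawing (Fin 4 × Fin (m + 1)) (Fin 9 × Fin (m + 1))}

/-- There is at most one odd pair that involves the `i`-th diamond, up to order. -/
def IsGood (P : ParityDrawing (Fin 4 × Fin (m + 1)) (Fin 9 × Fin (m + 1))) (i : Fin (m + 1)) :
    Prop :=
  ∀ p ∈ (ring m).oddPairs P, ∀ q ∈ (ring m).oddPairs P, InDiamond i p.1 → InDiamond i q.1 →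
    q = p ∨ q = p.swap

theorem four_le_card_diamondPairs {i : Fin (m + 1)} (h : ¬IsGood P i) :
    4 ≤ (diamondPairs P i).card := by
  classical
  unfold IsGood at h
  push Not at h
  obtain ⟨⟨e, f⟩, hp, ⟨e', f'⟩, hq, he, he', h1, h2⟩ := h
  have hne {e f} (h : (e, f) ∈ (ring m).oddPairs P) : e ≠ f := by
    rintro rfl
    exact ((ring m).mem_oddPairs P |>.1 h).1.1 rfl
  have hs : ({(e, f), (f, e), (e', f'), (f', e')} : Finset _) ⊆ diamondPairs P i := by
    intro x hx
    simp only [Finset.mem_insert, Finset.mem_singleton] at hx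
    rcases hx with rfl | rfl | rfl | rfl
    · exact Finset.mem_filter.2 ⟨hp, .inl he⟩
    · exact Finset.mem_filter.2 ⟨(ring m).swap_mem_oddPairs P hp, .inr he⟩
    · exact Finset.mem_filter.2 ⟨hq, .inl he'⟩
    · exact Finset.mem_filter.2 ⟨(ring m).swap_mem_oddPairs P hq, .inr he'⟩
  refine le_trans (le_of_eq ?_) (Finset.card_le_card hs)
  have hef := hne hp
  have hef' := hne hq
  rw [Finset.card_insert_of_notMem, Finset.card_insert_of_notMem, Finset.card_pair]
  all_goals
    simp only [Prod.swap_prod_mk, ne_eq, Prod.mk.injEq, Finset.mem_insert,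
      Finset.mem_singleton] at *
    grind

/-- A triangle of the diamond through a given edge. -/
def triangle (j : Fin 9) : Finset (Fin 9) := if j < 3 then {0, 1, 2} else {2, 3, 4}

theorem hasEnds_triangle (j : Fin 9) (i : Fin (m + 1)) :
    (ring m).HasEnds (triangle j ×ˢ {i}) (0, i) (0, i) := by
  intro g
  rw [Finset.sum_product]
  simp only [Finset.sum_singleton]
  have h2 (x : ZMod 2) := CharTwo.add_self_eq_zero x
  unfold triangle
  split
  · rw [Finset.sum_insert (by decide), Finset.sum_insert (by decide), Finset.sum_singleton]
    simp [ring, ringTl, ringHd]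
    linear_combination h2 (g (1, i)) + h2 (g (2, i))
  · rw [Finset.sum_insert (by decide), Finset.sum_insert (by decide), Finset.sum_singleton]
    simp [ring, ringTl, ringHd]
    linear_combination h2 (g (1, i)) + h2 (g (2, i)) + h2 (g (3, i)) - h2 (g (0, i))

/-- A cycle with four edges through the rail `e`. -/
def quadrilateral (e : Fin 9 × Fin (m + 1)) : Finset (Fin 9 × Fin (m + 1)) :=
  if e.1 < 7 then {(5, e.2), (6, e.2), (0, e.2), (0, e.2 + 1)}
  else {(7, e.2), (8, e.2), (4, e.2), (4, e.2 + 1)}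

theorem hasEnds_quadrilateral (hm : 0 < m) (e : Fin 9 × Fin (m + 1)) :
    (ring m).HasEnds (quadrilateral e) (0, e.2) (0, e.2) := by
  have : NeZero m := ⟨hm.ne'⟩
  obtain ⟨j, i⟩ := e
  intro g
  have h2 (x : ZMod 2) := CharTwo.add_self_eq_zero x
  have h0 : i ≠ i + 1 := by simp
  unfold quadrilateral
  split
  all_goals
    rw [Finset.sum_insert (by simp), Finset.sum_insert (by simp), Finset.sum_insert (by simp),
      Finset.sum_singleton]
    simp [ring, ringTl, ringHd]
  · linear_combination h2 (g (1, i)) + h2 (g (0, i + 1)) + h2 (g (1, i + 1))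
  · linear_combination h2 (g (2, i)) + h2 (g (3, i)) + h2 (g (2, i + 1)) + h2 (g (3, i + 1)) -
      h2 (g (0, i))

/-- An edge of the `i`-th diamond of a ring and an edge at another place. -/
def Far (x y : Fin 9 × Fin (m + 1)) : Prop :=
  x.1 < 5 ∧ y.2 ≠ x.2 ∧ (5 ≤ y.1 → y.2 + 1 ≠ x.2)

theorem Far.indep {x y : Fin 9 × Fin (m + 1)} (h : Far x y) : (ring m).Indep x y := by
  obtain ⟨h1, h2, h3⟩ := h
  simp only [Incidence.Indep, ring, ne_eq, Prod.ext_iff, not_and, h1, if_true]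
  split
  · exact ⟨fun _ => h2.symm, fun _ => h2.symm, fun _ => h2.symm, fun _ => h2.symm⟩
  · next h => exact ⟨fun _ => h2.symm, fun _ => (h3 (not_lt.1 h)).symm, fun _ => h2.symm,
      fun _ => (h3 (not_lt.1 h)).symm⟩

theorem cross_eq_zero_of_closed {x y : Fin 9 × Fin (m + 1)} (hg : IsGood P x.2)
    (hx : x.1 < 5) {C : Finset (Fin 9 × Fin (m + 1))} {v} (hC : (ring m).HasEnds C v v)
    (hy : y ∈ C) (hfar : ∀ x' y', x'.1 < 5 → x'.2 = x.2 → y' ∈ C → Far x' y') :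
    (ring m).cross P x y = 0 := by
  by_contra h0
  have hxy := hfar x y hx rfl hy
  have hodd : (x, y) ∈ (ring m).oddPairs P := ((ring m).mem_oddPairs P).2 ⟨hxy.indep, h0⟩
  have hx' : x ∈ triangle x.1 ×ˢ {x.2} := by
    have : ∀ j : Fin 9, j < 5 → j ∈ triangle j := by decide
    simp [this _ hx]
  have ht : ∀ x' ∈ triangle x.1 ×ˢ {x.2}, x'.1 < 5 ∧ x'.2 = x.2 := by
    have : ∀ j, ∀ k ∈ triangle j, k < 5 := by decide
    intro x' hx'
    simp only [Finset.mem_product, Finset.mem_singleton] at hx'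
    exact ⟨this _ _ hx'.1, hx'.2⟩
  have hsum := Incidence.sum_cross_closed P (hasEnds_triangle x.1 x.2) hC
  have hz : ∀ x' ∈ triangle x.1 ×ˢ {x.2}, ∀ y' ∈ C, (ring m).cross P x' y' ≠ 0 →
      x' = x ∧ y' = y := by
    intro x' hx' y' hy' h
    have hx' := ht x' hx'
    have hf := hfar x' y' hx'.1 hx'.2 hy'
    rcases hg _ hodd _ (((ring m).mem_oddPairs P).2 ⟨hf.indep, h⟩) ⟨hx, rfl⟩ hx' with h | h
    · exact Prod.mk.inj h
    · exact absurd ((show x' = y from (Prod.mk.inj h).1) ▸ hx'.2) hxy.2.1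
  rw [Finset.sum_eq_single x, Finset.sum_eq_single y] at hsum
  · exact h0 hsum
  · exact fun y' hy' hne => by_contra fun h => hne (hz x hx' y' hy' h).2
  · exact fun h => absurd hy h
  · exact fun x' hx' hne => Finset.sum_eq_zero fun y' hy' =>
      by_contra fun h => hne (hz x' hx' y' hy' h).1
  · exact fun h => absurd hx' h

theorem Far.cross_eq_zero (hm : 0 < m) {x y : Fin 9 × Fin (m + 1)} (h : Far x y)
    (hg : IsGood P x.2) : (ring m).cross P x y = 0 := by
  obtain ⟨h1, h2, h3⟩ := h
  by_cases hy : y.1 < 5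
  · refine cross_eq_zero_of_closed hg h1 (C := triangle y.1 ×ˢ {y.2}) (hasEnds_triangle _ _) ?_ ?_
    · have : ∀ j : Fin 9, j < 5 → j ∈ triangle j := by decide
      simp [this _ hy]
    · have : ∀ j, ∀ k ∈ triangle j, k < 5 := by decide
      intro x' y' hx1 hx2 hy'
      simp only [Finset.mem_product, Finset.mem_singleton] at hy'
      exact ⟨hx1, by rwa [hx2, hy'.2], fun h => absurd (this _ _ hy'.1) h.not_gt⟩
  · refine cross_eq_zero_of_closed hg h1 (C := quadrilateral y) (hasEnds_quadrilateral hm _) ?_ ?_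
    · obtain ⟨j, i⟩ := y
      dsimp only at hy
      unfold quadrilateral
      clear h2 h3
      fin_cases j <;> simp_all
    · intro x' y' hx1 hx2 hy'
      have h3 := h3 (not_lt.1 hy)
      unfold quadrilateral at hy'
      rw [← hx2] at h2 h3
      split at hy' <;> simp only [Finset.mem_insert, Finset.mem_singleton] at hy' <;>
        rcases hy' with rfl | rfl | rfl | rfl <;> simp [Far, hx1, h2, h3]

end Good

section Join

variable {m : ℕ} {P : ParityDrawing (Fin 4 × Fin (m + 1)) (Fin 9 × Fin (m + 1))}

theorem add_one_ne_self (hm : 2 ≤ m) (p : Fin (m + 1)) : p + 1 ≠ p := by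
  have : NeZero m := ⟨by omega⟩
  simp

theorem add_one_add_one_ne_self (hm : 2 ≤ m) (p : Fin (m + 1)) : p + 1 + 1 ≠ p := by
  rw [add_assoc, ne_eq, add_eq_left, Fin.ext_iff, Fin.val_add, Fin.val_one',
    Nat.mod_eq_of_lt (show 1 < m + 1 by omega), Nat.mod_eq_of_lt (by omega)]
  simp

/-- The places of the two poles. -/
def pole (p : Fin (m + 1)) (b : Bool) : Fin (m + 1) := cond b (p + 1 + 1) p

/-- The vertices of the join in a ring: the `p + 1`-st diamond and a vertex in each of the two
diamonds next to it. -/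
def joinVertex (hm : 2 ≤ m) (p : Fin (m + 1)) : Fin 4 ⊕ Bool ↪ Fin 4 × Fin (m + 1) where
  toFun := Sum.elim (fun k => (k, p + 1)) fun b => (0, pole p b)
  inj' := by
    have h1 := add_one_ne_self hm p
    have h2 := add_one_ne_self hm (p + 1)
    have h3 := add_one_add_one_ne_self hm p
    rintro (k | _ | _) (l | _ | _) h <;>
      simp_all [pole, eq_comm, -add_eq_left, -left_eq_add, -right_eq_add, -add_eq_right]

@[simp] theorem joinVertex_inl (hm : 2 ≤ m) (p : Fin (m + 1)) (k : Fin 4) :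
    joinVertex hm p (.inl k) = (k, p + 1) := rfl

@[simp] theorem joinVertex_inr (hm : 2 ≤ m) (p : Fin (m + 1)) (b : Bool) :
    joinVertex hm p (.inr b) = (0, pole p b) := rfl

/-- The main part of the chain of an edge of the join. -/
def joinCore (p : Fin (m + 1)) : Fin 5 ⊕ Option (Bool × Fin 4) → Fin 9 × Fin (m + 1)
  | .inl j => (Fin.castLE (by omega) j, p + 1)
  | .inr none => (0, p + 1)
  | .inr (some (b, k)) => (Fin.natAdd 5 k, cond b (p + 1) p)

/-- A path from the vertex `0` to the vertex `k` of the diamond. -/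
def diamondPath (k : Fin 4) : Finset (Fin 9) := ![∅, {0}, {1}, {0, 3}] k

/-- The chain of an edge of the join in a ring. -/
def joinChain (p : Fin (m + 1)) : Fin 5 ⊕ Option (Bool × Fin 4) → Finset (Fin 9 × Fin (m + 1))
  | .inl j => {joinCore p (.inl j)}
  | .inr none => {5} ×ˢ {p, p + 1}ᶜ
  | .inr (some (b, k)) => insert (joinCore p (.inr (some (b, k)))) (diamondPath k ×ˢ {pole p b})

theorem lt_of_mem_diamondPath {k : Fin 4} {j : Fin 9} (h : j ∈ diamondPath k) : j < 5 := by
  revert k j; decide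

theorem core_notMem (p : Fin (m + 1)) (b : Bool) (k : Fin 4) :
    joinCore p (.inr (some (b, k))) ∉ diamondPath k ×ˢ {pole p b} := fun h => by
  have := lt_of_mem_diamondPath (Finset.mem_product.1 h).1
  simp [joinCore, Fin.lt_def] at this

theorem hasEnds_joinChain (hm : 2 ≤ m) (p : Fin (m + 1)) (e) :
    (ring m).HasEnds (joinChain p e) (joinVertex hm p (joinGraph.tl e))
      (joinVertex hm p (joinGraph.hd e)) := by
  have h2 (x : ZMod 2) := CharTwo.add_self_eq_zero x
  intro g
  rcases e with j | _ | ⟨b, k⟩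
  · fin_cases j <;> simp [joinChain, joinCore, ring, joinGraph, ringTl, ringHd,
      diamondTl, diamondHd]
  · have hall : ∑ i : Fin (m + 1), (g (0, i) + g (0, i + 1)) = 0 := by
      rw [Finset.sum_add_distrib,
        Fintype.sum_equiv (Equiv.addRight (1 : Fin (m + 1))) (fun i => g (0, i + 1))
          (fun i => g (0, i)) fun i => rfl]
      exact h2 _
    rw [← Finset.sum_compl_add_sum {p, p + 1}, Finset.sum_pair (add_one_ne_self hm p).symm] at hall
    rw [joinChain, Finset.sum_product, Finset.sum_singleton]
    simp only [ring, joinGraph, ringTl, ringHd, pole, joinVertex_inr, Sum.elim_inr, Option.elim,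
      cond_true, cond_false]
    simp only [Matrix.cons_val, Fin.reduceLT, if_false]
    linear_combination hall - h2 (g (0, p + 1)) - h2 (g (0, p)) - h2 (g (0, p + 1 + 1))
  · rw [joinChain, Finset.sum_insert (core_notMem p b k), Finset.sum_product]
    simp only [Finset.sum_singleton]
    cases b <;> fin_cases k <;>
      simp [joinCore, ring, joinGraph, pole, diamondPath, ringTl, ringHd,
        Fin.lt_def]
    · linear_combination h2 (g (1, p))
    · linear_combination h2 (g (2, p))
    · linear_combination h2 (g (1, p)) + h2 (g (3, p))
    · exact add_comm _ _
    · linear_combination h2 (g (1, p + 1 + 1))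
    · linear_combination h2 (g (2, p + 1 + 1))
    · linear_combination h2 (g (1, p + 1 + 1)) + h2 (g (3, p + 1 + 1))

/-- The parity drawing of the join that is obtained from one of a ring. -/
def joinDrawing (P : ParityDrawing (Fin 4 × Fin (m + 1)) (Fin 9 × Fin (m + 1))) (hm : 2 ≤ m)
    (p : Fin (m + 1)) : ParityDrawing (Fin 4 ⊕ Bool) (Fin 5 ⊕ Option (Bool × Fin 4)) :=
  P.pull (joinVertex hm p) (joinChain p)

theorem cross_joinDrawing_inl (hm : 2 ≤ m) (hg : ∀ i, IsGood P i) (p : Fin (m + 1)) (j : Fin 5)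
    (f : Fin 5 ⊕ Option (Bool × Fin 4))
    (h : joinGraph.cross (joinDrawing P hm p) (.inl j) f ≠ 0) :
    f ≠ .inr none ∧
      (ring m).cross P (joinCore p (.inl j)) (joinCore p f) ≠ 0 := by
  have hp := add_one_ne_self hm p
  have hp1 := add_one_ne_self hm (p + 1)
  have hp2 := add_one_add_one_ne_self hm p
  have h0 : (joinCore p (.inl j)).1 < 5 := by simp [joinCore, Fin.lt_def]
  rw [joinDrawing, Incidence.cross_pull P _ _ (hasEnds_joinChain hm p)] at h
  rw [joinChain, Finset.sum_singleton] at h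
  rcases f with f | _ | ⟨b, k⟩
  · rw [joinChain, Finset.sum_singleton] at h
    exact ⟨by simp, h⟩
  · refine absurd (Finset.sum_eq_zero fun y hy => ?_) h
    refine Far.cross_eq_zero (by omega) ?_ (hg _)
    simp only [joinChain, Finset.mem_product, Finset.mem_singleton, Finset.mem_compl,
      Finset.mem_insert, not_or] at hy
    exact ⟨h0, hy.2.2, fun _ h => hy.2.1 (add_right_cancel h)⟩
  · rw [joinChain, Finset.sum_insert (core_notMem p b k), Finset.sum_eq_zero, add_zero] at h
    · exact ⟨by simp, h⟩
    · intro y hy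
      refine Far.cross_eq_zero (by omega) ?_ (hg _)
      simp only [Finset.mem_product, Finset.mem_singleton] at hy
      refine ⟨h0, ?_, fun h => absurd (lt_of_mem_diamondPath hy.1) h.not_gt⟩
      rw [hy.2]
      cases b
      exacts [hp.symm, hp1]

theorem cross_joinDrawing_inr (hm : 2 ≤ m) (hg : ∀ i, IsGood P i) (p : Fin (m + 1)) (k l : Fin 4) :
    joinGraph.cross (joinDrawing P hm p) (.inr (some (false, k))) (.inr (some (true, l))) =
      (ring m).cross P (joinCore p (.inr (some (false, k))))
        (joinCore p (.inr (some (true, l)))) := by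
  have hp := add_one_ne_self hm p
  have hp1 := add_one_ne_self hm (p + 1)
  have hp2 := add_one_add_one_ne_self hm p
  rw [joinDrawing, Incidence.cross_pull P _ _ (hasEnds_joinChain hm p)]
  rw [joinChain, joinChain, ← Finset.sum_product', Finset.sum_eq_single
    (joinCore p (.inr (some (false, k))), joinCore p (.inr (some (true, l))))]
  · rintro ⟨x, y⟩ hxy hne
    rw [Finset.mem_product, Finset.mem_insert, Finset.mem_insert, Finset.mem_product,
      Finset.mem_product, Finset.mem_singleton, Finset.mem_singleton] at hxy
    dsimp only [pole, cond_true, cond_false] at hxy ⊢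
    rcases hxy with ⟨rfl | ⟨h1, h2⟩, rfl | ⟨h3, h4⟩⟩
    · exact absurd rfl hne
    · have hf : Far y (joinCore p (.inr (some (false, k)))) := by
        refine ⟨lt_of_mem_diamondPath h3, ?_⟩
        rw [h4]
        exact ⟨hp2.symm, fun _ => hp1.symm⟩
      rw [← Incidence.cross_comm P hf.indep]
      exact hf.cross_eq_zero (by omega) (hg _)
    · refine Far.cross_eq_zero (by omega) ⟨lt_of_mem_diamondPath h1, ?_⟩ (hg _)
      rw [h2]
      exact ⟨hp, fun _ => hp2⟩
    · refine Far.cross_eq_zero (by omega) ⟨lt_of_mem_diamondPath h1, ?_⟩ (hg _)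
      rw [h2, h4]
      exact ⟨hp2, fun h => absurd (lt_of_mem_diamondPath h3) h.not_gt⟩
  · intro h
    simp at h

/-- The place to which an odd pair is attributed. -/
def owner (q : (Fin 9 × Fin (m + 1)) × (Fin 9 × Fin (m + 1))) : Fin (m + 1) :=
  if q.1.1 < 5 then q.1.2 else if q.2.1 < 5 then q.2.2
  else if q.2.2 = q.1.2 + 1 then q.2.2 else q.1.2

theorem ringTl_castLE (j : Fin 5) : ringTl (Fin.castLE (by omega) j) = diamondTl j := by
  revert j; decide

theorem ringHd_castLE (j : Fin 5) : ringHd (Fin.castLE (by omega) j) = diamondHd j := by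
  revert j; decide

theorem ringTl_natAdd (k : Fin 4) : ringTl (Fin.natAdd 5 k) = k := by
  revert k; decide

theorem ringHd_natAdd (k : Fin 4) : ringHd (Fin.natAdd 5 k) = k := by
  revert k; decide

theorem indep_joinCore (hm : 2 ≤ m) {p : Fin (m + 1)} {e f} (h : joinGraph.Indep e f)
    (he : e ≠ .inr none) (hf : f ≠ .inr none) :
    (ring m).Indep (joinCore p e) (joinCore p f) ∧
      owner (joinCore p e, joinCore p f) = p + 1 := by
  have hp := add_one_ne_self hm p
  have hp1 := add_one_ne_self hm (p + 1)
  have hp2 := add_one_add_one_ne_self hm p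
  have hd (j : Fin 5) : Fin.castLE (show 5 ≤ 9 by omega) j < 5 := by simp [Fin.lt_def]
  have hr (k : Fin 4) : ¬Fin.natAdd 5 k < 5 := by simp [Fin.lt_def]
  rcases e with j | _ | ⟨b, k⟩ <;> rcases f with j' | _ | ⟨b', l⟩
  · simpa [Incidence.Indep, joinGraph, ring, joinCore, owner, hd, ringTl_castLE,
      ringHd_castLE] using h
  · exact absurd rfl hf
  · cases b' <;> simp_all [Incidence.Indep, joinGraph, ring, joinCore, owner, ringTl_castLE,
      ringHd_castLE, ringTl_natAdd, ringHd_natAdd]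
  · exact absurd rfl he
  · exact absurd rfl he
  · exact absurd rfl he
  · cases b <;> simp_all [Incidence.Indep, joinGraph, ring, joinCore, owner, ringTl_castLE,
      ringHd_castLE, ringTl_natAdd, ringHd_natAdd]
  · exact absurd rfl hf
  · cases b <;> cases b' <;> simp_all [Incidence.Indep, joinGraph, ring, joinCore, owner,
      ringTl_natAdd, ringHd_natAdd, -add_eq_left, -left_eq_add, eq_comm]

theorem cross_joinCore_ne_zero (hm : 2 ≤ m) (hg : ∀ i, IsGood P i) {p : Fin (m + 1)} {e f}
    (hi : joinGraph.Indep e f) (h : joinGraph.cross (joinDrawing P hm p) e f ≠ 0) :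
    e ≠ .inr none ∧ f ≠ .inr none ∧ (ring m).cross P (joinCore p e) (joinCore p f) ≠ 0 := by
  have key {e f} (hi : joinGraph.Indep e f)
      (h : joinGraph.cross (joinDrawing P hm p) f e ≠ 0 → f ≠ .inr none ∧ e ≠ .inr none ∧
        (ring m).cross P (joinCore p f) (joinCore p e) ≠ 0)
      (h' : joinGraph.cross (joinDrawing P hm p) e f ≠ 0) : e ≠ .inr none ∧ f ≠ .inr none ∧
        (ring m).cross P (joinCore p e) (joinCore p f) ≠ 0 := by
    rw [Incidence.cross_comm _ hi] at h'
    obtain ⟨h1, h2, h3⟩ := h h'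
    exact ⟨h2, h1, by rwa [Incidence.cross_comm P (indep_joinCore hm hi h2 h1).1]⟩
  rcases e with j | _ | ⟨b, k⟩
  · exact ⟨Sum.inl_ne_inr, cross_joinDrawing_inl hm hg p _ _ h⟩
  · rcases f with j' | _ | ⟨b', l⟩
    · exact key hi (fun h => ⟨Sum.inl_ne_inr, cross_joinDrawing_inl hm hg p _ _ h⟩) h
    · simp [Incidence.Indep, joinGraph] at hi
    · cases b' <;> simp [Incidence.Indep, joinGraph] at hi
  · rcases f with j' | _ | ⟨b', l⟩
    · exact key hi (fun h => ⟨Sum.inl_ne_inr, cross_joinDrawing_inl hm hg p _ _ h⟩) h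
    · cases b <;> simp [Incidence.Indep, joinGraph] at hi
    · cases b <;> cases b'
      · simp [Incidence.Indep, joinGraph] at hi
      · exact ⟨by simp, by simp, by rwa [cross_joinDrawing_inr hm hg] at h⟩
      · exact key hi (fun h => ⟨by simp, by simp, by rwa [cross_joinDrawing_inr hm hg] at h⟩) h
      · simp [Incidence.Indep, joinGraph] at hi

theorem four_le_card_owner (hm : 2 ≤ m) (hg : ∀ i, IsGood P i) (p : Fin (m + 1)) :
    4 ≤ {q ∈ (ring m).oddPairs P | owner q = p + 1}.card := by
  classical
  refine (four_le_card_oddPairs_joinGraph (joinDrawing P hm p)).trans ?_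
  let π : Fin 9 × Fin (m + 1) → Fin 5 ⊕ Option (Bool × Fin 4) := fun x =>
    if h : x.1 < 5 then .inl ⟨x.1, h⟩ else .inr (some (decide (x.2 = p + 1), ⟨x.1 - 5, by omega⟩))
  have hπ (e) (he : e ≠ .inr none) : π (joinCore p e) = e := by
    rcases e with j | _ | ⟨b, k⟩
    · simp [π, joinCore, Fin.lt_def]
    · exact absurd rfl he
    · cases b <;> simp [π, joinCore, Fin.lt_def, (add_one_ne_self hm p).symm]
  refine Finset.card_le_card_of_surjOn (Prod.map π π) ?_
  rintro ⟨e, f⟩ hp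
  obtain ⟨hi, h0⟩ := (joinGraph.mem_oddPairs _).1 hp
  obtain ⟨he, hf, hc⟩ := cross_joinCore_ne_zero hm hg hi h0
  obtain ⟨hi', ho⟩ := indep_joinCore (p := p) hm hi he hf
  refine ⟨(joinCore p e, joinCore p f), ?_, Prod.ext (hπ e he) (hπ f hf)⟩
  exact Finset.mem_coe.2 (Finset.mem_filter.2 ⟨((ring m).mem_oddPairs P).2 ⟨hi', hc⟩, ho⟩)

theorem card_oddPairs_of_isGood (hm : 2 ≤ m) (hg : ∀ i, IsGood P i) :
    4 * (m + 1) ≤ ((ring m).oddPairs P).card := by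
  rw [Finset.card_eq_sum_card_fiberwise (f := owner) (t := Finset.univ) fun _ _ => by simp]
  have := Finset.card_nsmul_le_sum Finset.univ
    (fun i => {q ∈ (ring m).oddPairs P | owner q = i}.card) 4 fun i _ => by
      simpa using four_le_card_owner hm hg (i - 1)
  rw [Finset.card_univ, Fintype.card_fin, smul_eq_mul] at this
  omega

end Join

theorem four_mul_le_card_oddPairs_ring {m : ℕ} (hm : 2 ≤ m)
    (P : ParityDrawing (Fin 4 × Fin (m + 1)) (Fin 9 × Fin (m + 1))) :
    4 * (m + 1) ≤ ((ring m).oddPairs P).card := by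
  induction m, hm using Nat.le_induction with
  | base => exact twelve_le_card_oddPairs_ring_two P
  | succ m hm ih =>
    by_cases hg : ∀ i, IsGood P i
    · exact card_oddPairs_of_isGood (by omega) hg
    · push Not at hg
      obtain ⟨i, hi⟩ := hg
      obtain ⟨P', hP'⟩ := exists_card_oddPairs_add_le P i
      have := ih P'
      have := four_le_card_diamondPairs hi
      omega

/-! ### The lower bound -/

theorem Drawing.card_oddPairs_le {V : Type*} {G : SimpleGraph V} [Fintype G.edgeSet]
    [DecidableEq V] (D : Drawing G) (hD : D.crossings.Finite) {I : Incidence V G.edgeSet}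
    {P : ParityDrawing V G.edgeSet}
    (h : ∀ e f, I.Indep e f → I.cross P e f ≠ 0 → ∃ p, (s(e, f), p) ∈ D.crossings) :
    (I.oddPairs P).card ≤ 2 * D.crossings.ncard := by
  classical
  rw [Set.ncard_eq_toFinset_card _ hD]
  refine (Finset.card_le_mul_card_image_of_maps_to (f := fun q => s(q.1, q.2))
    (t := hD.toFinset.image Prod.fst) ?_ 2 ?_).trans
    (Nat.mul_le_mul_left _ Finset.card_image_le)
  · rintro ⟨e, f⟩ hq
    obtain ⟨hi, h0⟩ := (I.mem_oddPairs P).1 hq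
    obtain ⟨p, hp⟩ := h e f hi h0
    exact Finset.mem_image.2 ⟨_, hD.mem_toFinset.2 hp, rfl⟩
  · intro b _
    induction b with | _ e f
    refine (Finset.card_le_card (t := {(e, f), (f, e)}) fun q hq => ?_).trans
      (Finset.card_le_two ..)
    rcases Sym2.eq_iff.1 (Finset.mem_filter.1 hq).2 with ⟨h1, h2⟩ | ⟨h1, h2⟩ <;>
      simp [← h1, ← h2]

theorem ring_injective {m : ℕ} (hm : 2 ≤ m) {e f : Fin 9 × Fin (m + 1)}
    (h : s((ring m).tl e, (ring m).hd e) = s((ring m).tl f, (ring m).hd f)) : e = f := by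
  obtain ⟨a, i⟩ := e
  obtain ⟨b, j⟩ := f
  simp only [ring, Sym2.eq_iff, Prod.mk.injEq] at h
  rcases h with ⟨⟨h1, rfl⟩, h2, -⟩ | ⟨⟨h1, h2⟩, h3, h4⟩
  · have : ∀ a b, ringTl a = ringTl b → ringHd a = ringHd b → a = b := by decide
    rw [this a b h1 h2]
  · have : ∀ a b, ringTl a = ringHd b → ringHd a = ringTl b → ¬a < 5 ∧ ¬b < 5 := by decide
    obtain ⟨ha, hb⟩ := this a b h1 h3
    rw [if_neg hb] at h2
    rw [if_neg ha, h2] at h4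
    exact absurd h4 (add_one_add_one_ne_self hm j)

theorem natAdd_ring_adj {m : ℕ} (hm : 2 ≤ m) (e : Fin 9 × Fin (m + 1)) :
    (G6_63 □ cycleGraph (m + 1)).Adj (Fin.natAdd 2 (ringTl e.1), e.2)
      (Fin.natAdd 2 (ringHd e.1), if e.1 < 5 then e.2 else e.2 + 1) := by
  obtain ⟨a, i⟩ := e
  rw [boxProd_adj]
  by_cases h : a < 5
  · refine .inl ⟨?_, by simp [h]⟩
    revert a
    simp only [G6_63, fromEdgeSet_adj, Set.mem_insert_iff, Set.mem_singleton_iff]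
    decide
  · refine .inr ⟨by simp [h, cycleGraph_adj', show m = 1 ∨ 0 < m by omega], ?_⟩
    dsimp only
    clear i
    revert a
    decide

theorem two_mul_le_ncard_crossings {m : ℕ} (hm : 2 ≤ m)
    (D : Drawing (G6_63 □ cycleGraph (m + 1))) (hD : D.crossings.Finite) :
    2 * (m + 1) ≤ D.crossings.ncard := by
  classical
  obtain ⟨I, P, hI, hP⟩ := D.exists_parityDrawing
  let ι : Fin 4 × Fin (m + 1) ↪ Fin 6 × Fin (m + 1) :=
    ⟨fun x => (Fin.natAdd 2 x.1, x.2), fun x y h => by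
      have h' := Prod.ext_iff.1 h
      exact Prod.ext (Fin.natAdd_inj 2 |>.1 h'.1) h'.2⟩
  let κ (e : Fin 9 × Fin (m + 1)) : (G6_63 □ cycleGraph (m + 1)).edgeSet :=
    ⟨s(ι ((ring m).tl e), ι ((ring m).hd e)), natAdd_ring_adj hm e⟩
  have hκ (e) : s(I.tl (κ e), I.hd (κ e)) = s(ι ((ring m).tl e), ι ((ring m).hd e)) :=
    (hI (κ e)).symm
  have hinj : Function.Injective κ := fun e f h => ring_injective hm <|
    Sym2.map.injective ι.injective (Subtype.ext_iff.1 h)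
  have h1 := four_mul_le_card_oddPairs_ring hm (P.pull ι fun e => {κ e})
  have h2 := Incidence.card_oddPairs_pull_singleton_le P hκ hinj
  have h3 := D.card_oddPairs_le hD hP
  omega

/-! ### The upper bound -/

/-- The point with the distance `h` from the origin after `θ / n` of a turn. -/
noncomputable def annulusPoint (n : ℕ) (h θ : ℝ) : ℝ × ℝ :=
  (h * Real.cos (2 * Real.pi * (θ / n)), h * Real.sin (2 * Real.pi * (θ / n)))

theorem annulusPoint_add_mul {n : ℕ} [NeZero n] (h θ : ℝ) (k : ℤ) :
    annulusPoint n h (θ + k * n) = annulusPoint n h θ := by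
  have hn : (n : ℝ) ≠ 0 := NeZero.ne _
  have : 2 * Real.pi * ((θ + k * n) / n) = 2 * Real.pi * (θ / n) + k * (2 * Real.pi) := by
    field_simp
  simp only [annulusPoint, this, Real.cos_add_int_mul_two_pi, Real.sin_add_int_mul_two_pi]

theorem eq_of_annulusPoint_eq {n : ℕ} [NeZero n] {h h' θ θ' : ℝ} (h0 : 0 < h) (h0' : 0 < h')
    (H : annulusPoint n h θ = annulusPoint n h' θ') : h = h' ∧ ∃ k : ℤ, θ - θ' = k * n := by
  have hn : (n : ℝ) ≠ 0 := NeZero.ne _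
  obtain ⟨h1, h2⟩ := Prod.ext_iff.1 H
  simp only [annulusPoint] at h1 h2
  have hh : h = h' := by
    have e : h ^ 2 = h' ^ 2 := by
      have s1 := Real.sin_sq_add_cos_sq (2 * Real.pi * (θ / n))
      have s2 := Real.sin_sq_add_cos_sq (2 * Real.pi * (θ' / n))
      linear_combination (h * Real.cos (2 * Real.pi * (θ / n)) +
        h' * Real.cos (2 * Real.pi * (θ' / n))) * h1 +
        (h * Real.sin (2 * Real.pi * (θ / n)) + h' * Real.sin (2 * Real.pi * (θ' / n))) * h2 -
        h ^ 2 * s1 + h' ^ 2 * s2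
    exact (sq_eq_sq₀ h0.le h0'.le).1 e
  subst hh
  refine ⟨rfl, ?_⟩
  obtain ⟨k, hk⟩ := Real.Angle.angle_eq_iff_two_pi_dvd_sub.1 <| Real.Angle.cos_sin_inj
    (mul_left_cancel₀ h0.ne' h1) (mul_left_cancel₀ h0.ne' h2)
  refine ⟨k, ?_⟩
  have hπ := Real.pi_ne_zero
  field_simp at hk
  linarith

theorem Fin.eq_of_sub_eq_mul {m : ℕ} {i j : Fin (m + 1)} {k : ℤ}
    (h : (i : ℤ) - j = k * (m + 1 : ℕ)) : i = j := by
  have hi := i.2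
  have hj := j.2
  have := Int.eq_zero_of_abs_lt_dvd ⟨k, h.trans (mul_comm _ _)⟩ (abs_lt.2 ⟨by omega, by omega⟩)
  ext
  omega

theorem Fin.exists_add_one_eq {m : ℕ} (i : Fin (m + 1)) :
    ∃ k : ℤ, ((i + 1 : Fin (m + 1)) : ℤ) = i + 1 + k * (m + 1 : ℕ) := by
  rw [Fin.val_add_one]
  split_ifs with h
  · exact ⟨-1, by simp [h]⟩
  · exact ⟨0, by simp⟩

theorem Int.eq_of_lt_of_lt {x : ℝ} {y z : ℤ} (h : z - 1 < x) (h' : x < z + 1)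
    (hxy : x = y) : y = z := by
  rw [hxy] at h h'
  norm_cast at h h'
  omega

theorem Int.cast_ne_of_lt_of_lt {x : ℝ} (h : 0 < x) (h' : x < 1) (y : ℤ) : x ≠ y := by
  rintro rfl
  norm_cast at h h'
  omega

/-- The kinds of edges of the product: the edges of the path, the two chords, and the rails, which
are the edges of the cycles. -/
inductive Piece
  | path (k : Fin 5)
  | chord (b : Bool)
  | rail (k : Fin 6)

namespace Piece

/-- The first end of an edge. -/
def tl : Piece → Fin 6
  | path k => k.castSucc
  | chord b => cond b 3 2
  | rail k => k

/-- The second end of an edge. -/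
def hd : Piece → Fin 6
  | path k => k.succ
  | chord b => cond b 5 4
  | rail k => k

/-- The place in the cycle of the second end of an edge whose first end has the place `i`. -/
def next {m : ℕ} : Piece → Fin (m + 1) → Fin (m + 1)
  | rail _, i => i + 1
  | _, i => i

/-- The distance from the origin along the arc of an edge. -/
noncomputable def height : Piece → ℝ → ℝ
  | path k, t => k + 1 + t
  | chord b, t => cond b 4 3 + 2 * t
  | rail k, _ => k + 1

/-- The part of a turn along the arc of an edge. -/
noncomputable def angle : Piece → ℝ → ℝ
  | path _, _ => 0
  | chord b, t => cond b (-1) 1 * (t * (1 - t))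
  | rail _, t => t

theorem height_pos (a : Piece) {t : ℝ} (ht : 0 ≤ t) : 0 < a.height t := by
  rcases a with k | (_ | _) | k <;> simp only [height, cond_true, cond_false] <;> positivity

theorem continuous_height (a : Piece) : Continuous a.height := by
  rcases a with k | b | k <;> unfold height <;> fun_prop

theorem continuous_angle (a : Piece) : Continuous a.angle := by
  rcases a with k | b | k <;> unfold angle <;> fun_prop

theorem height_zero (a : Piece) : a.height 0 = a.tl + 1 := by
  rcases a with k | (_ | _) | k <;> norm_num [height, tl]

theorem height_one (a : Piece) : a.height 1 = a.hd + 1 := by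
  rcases a with k | (_ | _) | k <;> norm_num [height, hd]

theorem angle_zero (a : Piece) : a.angle 0 = 0 := by
  rcases a with k | b | k <;> simp [angle]

theorem exists_next_eq {m : ℕ} (a : Piece) (i : Fin (m + 1)) :
    ∃ k : ℤ, (a.next i : ℝ) = i + a.angle 1 + k * (m + 1 : ℕ) := by
  rcases a with _ | _ | _
  · exact ⟨0, by simp [next, angle]⟩
  · exact ⟨0, by simp [next, angle]⟩
  · obtain ⟨k, hk⟩ := Fin.exists_add_one_eq i
    exact ⟨k, by simp only [next, angle]; exact_mod_cast hk⟩

theorem angle_mem (a : Piece) {t : ℝ} (ht : t ∈ Set.Icc (0 : ℝ) 1) :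
    a.angle t ∈ Set.Icc (-1 : ℝ) 1 := by
  obtain ⟨h0, h1⟩ := ht
  rcases a with k | (_ | _) | k <;> simp only [angle, cond_true, cond_false] <;>
    constructor <;> nlinarith

theorem eq_of_height_eq_of_angle_eq (a : Piece) {s t : ℝ} (h : a.height s = a.height t)
    (h' : a.angle s = a.angle t) : s = t := by
  rcases a with k | b | k <;> simp only [height, angle] at h h' <;> linarith

/-- The interior of an arc avoids the vertices. -/
theorem angle_ne_of_height_eq (a : Piece) {t : ℝ} (ht : t ∈ Set.Ioo (0 : ℝ) 1) {k : ℕ}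
    (h : a.height t = k + 1) (z : ℤ) : a.angle t ≠ z := by
  obtain ⟨h0, h1⟩ := ht
  intro H
  rcases a with j | (_ | _) | j <;> simp only [height, angle, cond_true, cond_false] at h H
  · refine Int.cast_ne_of_lt_of_lt h0 h1 (k - j) ?_
    push_cast
    linarith
  · exact Int.cast_ne_of_lt_of_lt (by nlinarith) (by nlinarith) z ((one_mul _).symm.trans H)
  · refine Int.cast_ne_of_lt_of_lt (x := t * (1 - t)) (by nlinarith) (by nlinarith) (-z) ?_
    push_cast
    linarith
  · exact Int.cast_ne_of_lt_of_lt h0 h1 z H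

theorem path_meets {k : Fin 5} {b : Piece} {s t : ℝ} (hs : s ∈ Set.Ioo (0 : ℝ) 1)
    (ht : t ∈ Set.Ioo (0 : ℝ) 1) (h : (path k).height s = b.height t) {z : ℤ}
    (H : b.angle t = z) : path k = b ∧ z = 0 := by
  obtain ⟨hs0, hs1⟩ := hs
  obtain ⟨ht0, ht1⟩ := ht
  rcases b with j | (_ | _) | j <;> simp only [height, angle, cond_true, cond_false] at h H
  · have : (j : ℤ) - k = 0 := Int.eq_of_lt_of_lt (x := s - t) (by push_cast; linarith)
      (by push_cast; linarith) (by push_cast; linarith)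
    refine ⟨?_, by exact_mod_cast H.symm⟩
    congr 1
    omega
  · exact absurd ((one_mul _).symm.trans H)
      (Int.cast_ne_of_lt_of_lt (by nlinarith) (by nlinarith) z)
  · exact absurd (by push_cast; linarith) (Int.cast_ne_of_lt_of_lt (x := t * (1 - t)) (by nlinarith)
      (by nlinarith) (-z))
  · exact absurd H (Int.cast_ne_of_lt_of_lt ht0 ht1 z)

theorem chord_meets_chord {b c : Bool} {s t : ℝ} (hs : s ∈ Set.Ioo (0 : ℝ) 1)
    (ht : t ∈ Set.Ioo (0 : ℝ) 1) {z : ℤ}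
    (H : (chord b).angle s - (chord c).angle t = z) : chord b = chord c ∧ z = 0 := by
  obtain ⟨hs0, hs1⟩ := hs
  obtain ⟨ht0, ht1⟩ := ht
  have s0 : 0 < s * (1 - s) := by nlinarith
  have t0 : 0 < t * (1 - t) := by nlinarith
  have s1 : s * (1 - s) < 1 / 2 := by nlinarith [sq_nonneg (s - 1 / 2)]
  have t1 : t * (1 - t) < 1 / 2 := by nlinarith [sq_nonneg (t - 1 / 2)]
  rcases b with _ | _ <;> rcases c with _ | _ <;> simp only [angle, cond_true, cond_false] at H
  · exact ⟨rfl, Int.eq_of_lt_of_lt (by push_cast; linarith) (by push_cast; linarith) H⟩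
  · exact absurd H <| mt (fun h => by linarith) <|
      Int.cast_ne_of_lt_of_lt (x := s * (1 - s) + t * (1 - t))
      (by linarith) (by linarith) z
  · exact absurd (by push_cast; linarith) <|
      Int.cast_ne_of_lt_of_lt (x := s * (1 - s) + t * (1 - t))
      (by linarith) (by linarith) (-z)
  · exact ⟨rfl, Int.eq_of_lt_of_lt (by push_cast; linarith) (by push_cast; linarith) H⟩

theorem chord_meets_rail {b : Bool} {k : Fin 6} {s t : ℝ} (hs : s ∈ Set.Ioo (0 : ℝ) 1)
    (ht : t ∈ Set.Ioo (0 : ℝ) 1) (h : (chord b).height s = (rail k).height t) {z : ℤ}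
    (H : (chord b).angle s - (rail k).angle t = z) :
    k = cond b 4 3 ∧ s = 1 / 2 ∧ z = cond b (-1) 0 := by
  obtain ⟨hs0, hs1⟩ := hs
  obtain ⟨ht0, ht1⟩ := ht
  rcases b with _ | _ <;> simp only [height, angle, cond_true, cond_false] at h H ⊢
  · have hk : (k : ℤ) - 2 = 1 := Int.eq_of_lt_of_lt (x := 2 * s) (by push_cast; linarith)
      (by push_cast; linarith) (by push_cast; linarith)
    have hk' : k = 3 := by ext; simp; omega
    subst hk'
    norm_num at h
    obtain rfl : s = 1 / 2 := by linarith
    exact ⟨rfl, rfl, Int.eq_of_lt_of_lt (by push_cast; linarith) (by push_cast; linarith) H⟩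
  · have hk : (k : ℤ) - 3 = 1 := Int.eq_of_lt_of_lt (x := 2 * s) (by push_cast; linarith)
      (by push_cast; linarith) (by push_cast; linarith)
    have hk' : k = 4 := by ext; simp; omega
    subst hk'
    norm_num at h
    obtain rfl : s = 1 / 2 := by linarith
    refine ⟨rfl, rfl, Int.eq_of_lt_of_lt (by push_cast; linarith) (by push_cast; linarith) H⟩

theorem rail_meets_rail {k l : Fin 6} {s t : ℝ} (hs : s ∈ Set.Ioo (0 : ℝ) 1)
    (ht : t ∈ Set.Ioo (0 : ℝ) 1) (h : (rail k).height s = (rail l).height t) {z : ℤ}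
    (H : (rail k).angle s - (rail l).angle t = z) : rail k = rail l ∧ z = 0 := by
  obtain ⟨hs0, hs1⟩ := hs
  obtain ⟨ht0, ht1⟩ := ht
  simp only [height, angle, add_left_inj, Nat.cast_inj] at h H
  exact ⟨congrArg _ (Fin.ext h),
    Int.eq_of_lt_of_lt (by push_cast; linarith) (by push_cast; linarith) H⟩

/-- Two arcs of a product meet only if they belong to the same edge or to a chord and a rail. -/
theorem meets {a b : Piece} {s t : ℝ} (hs : s ∈ Set.Ioo (0 : ℝ) 1)
    (ht : t ∈ Set.Ioo (0 : ℝ) 1) (h : a.height s = b.height t) {z : ℤ}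
    (H : a.angle s - b.angle t = z) : a = b ∧ z = 0 ∨
      (∃ c, a = chord c ∧ b = rail (cond c 4 3) ∧ s = 1 / 2 ∧ z = cond c (-1) 0) ∨
      ∃ c, b = chord c ∧ a = rail (cond c 4 3) ∧ t = 1 / 2 ∧ -z = cond c (-1) 0 := by
  have H' : b.angle t - a.angle s = (-z : ℤ) := by push_cast; linarith
  rcases a with k | c | k
  · obtain ⟨h1, h2⟩ := path_meets hs ht h ((sub_zero _).symm.trans H')
    exact .inl ⟨h1, by omega⟩
  · rcases b with l | c' | l
    · obtain ⟨h1, h2⟩ := path_meets ht hs h.symm ((sub_zero _).symm.trans H)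
      exact .inl ⟨h1.symm, h2⟩
    · exact .inl (chord_meets_chord hs ht H)
    · obtain ⟨h1, h2⟩ := chord_meets_rail hs ht h H
      exact .inr (.inl ⟨_, rfl, congrArg _ h1, h2⟩)
  · rcases b with l | c' | l
    · obtain ⟨h1, h2⟩ := path_meets ht hs h.symm ((sub_zero _).symm.trans H)
      exact .inl ⟨h1.symm, h2⟩
    · obtain ⟨h1, h2⟩ := chord_meets_rail ht hs h.symm H'
      exact .inr (.inr ⟨_, rfl, congrArg _ h1, h2⟩)
    · exact .inl (rail_meets_rail hs ht h H)

end Piece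

section ProductDrawing

variable {m : ℕ}

theorem exists_edge (hm : 1 ≤ m) :
    ∃ edge : Piece × Fin (m + 1) → (G6_63 □ cycleGraph (m + 1)).edgeSet,
    Function.Surjective edge ∧ ∀ c, (edge c : Sym2 (Fin 6 × Fin (m + 1))) =
      s((c.1.tl, c.2), (c.1.hd, c.1.next c.2)) := by
  have adj (c : Piece × Fin (m + 1)) : (G6_63 □ cycleGraph (m + 1)).Adj (c.1.tl, c.2)
      (c.1.hd, c.1.next c.2) := by
    obtain ⟨k | b | k, i⟩ := c
    · refine .inl ⟨?_, rfl⟩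
      simp only [G6_63, fromEdgeSet_adj, Piece.tl, Piece.hd]
      revert k; decide
    · refine .inl ⟨?_, rfl⟩
      simp only [G6_63, fromEdgeSet_adj, Piece.tl, Piece.hd]
      revert b; decide
    · refine .inr ⟨?_, rfl⟩
      simp [Piece.next, cycleGraph_adj', show m = 1 ∨ 0 < m by omega]
  refine ⟨fun c => ⟨_, adj c⟩, ?_, fun _ => rfl⟩
  rintro ⟨e, he⟩
  induction e with | _ x y
  obtain ⟨x, i⟩ := x
  obtain ⟨y, j⟩ := y
  suffices ∃ c : Piece × Fin (m + 1), s((x, i), (y, j)) =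
      s((c.1.tl, c.2), (c.1.hd, c.1.next c.2)) from
    this.imp fun c hc => Subtype.ext hc.symm
  rcases he with ⟨h, h'⟩ | ⟨h, h'⟩
  · obtain rfl : i = j := h'
    have : ∀ x y, G6_63.Adj x y → (∃ k : Fin 5, s(x, y) = s(k.castSucc, k.succ)) ∨
        ∃ b : Bool, s(x, y) = s(cond b 3 2, cond b 5 4) := by
      simp only [G6_63, fromEdgeSet_adj, Set.mem_insert_iff, Set.mem_singleton_iff]
      decide
    rcases this x y h with ⟨k, h⟩ | ⟨b, h⟩
    · refine ⟨(.path k, i), ?_⟩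
      simpa [Piece.tl, Piece.hd, Piece.next] using h
    · refine ⟨(.chord b, i), ?_⟩
      simpa [Piece.tl, Piece.hd, Piece.next] using h
  · obtain rfl : x = y := h'
    have hval (u : Fin (m + 1)) (hu : u.val = 1) : u = 1 := by
      ext
      rw [hu, Fin.val_one', Nat.mod_eq_of_lt (by omega)]
    rcases cycleGraph_adj'.1 h with h | h
    · refine ⟨(.rail x, j), ?_⟩
      rw [Sym2.eq_swap]
      simp [Piece.tl, Piece.hd, Piece.next, ← hval _ h]
    · refine ⟨(.rail x, i), ?_⟩
      simp [Piece.tl, Piece.hd, Piece.next, ← hval _ h]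

/-- The arc of an edge of the product. -/
noncomputable def productArc (c : Piece × Fin (m + 1)) (t : ℝ) : ℝ × ℝ :=
  annulusPoint (m + 1) (c.1.height t) (c.2 + c.1.angle t)

theorem continuous_productArc (c : Piece × Fin (m + 1)) : Continuous (productArc c) := by
  have := c.1.continuous_height
  have := c.1.continuous_angle
  unfold productArc annulusPoint
  fun_prop

theorem productArc_eq {c d : Piece × Fin (m + 1)} {s t : ℝ} (hs : 0 ≤ s) (ht : 0 ≤ t)
    (h : productArc c s = productArc d t) : c.1.height s = d.1.height t ∧ ∃ k : ℤ,
      c.1.angle s - d.1.angle t = (k * (m + 1 : ℕ) + d.2 - c.2 : ℤ) := by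
  obtain ⟨h1, k, hk⟩ := eq_of_annulusPoint_eq (c.1.height_pos hs) (d.1.height_pos ht) h
  refine ⟨h1, k, ?_⟩
  push_cast at hk ⊢
  linarith

theorem injOn_productArc (hm : 2 ≤ m) (c : Piece × Fin (m + 1)) :
    Set.InjOn (productArc c) (Set.Icc 0 1) := by
  intro s hs t ht h
  obtain ⟨h1, k, hk⟩ := productArc_eq hs.1 ht.1 h
  refine c.1.eq_of_height_eq_of_angle_eq h1 (sub_eq_zero.1 ?_)
  have hs' := c.1.angle_mem hs
  have ht' := c.1.angle_mem ht
  have h2 : |((k * (m + 1 : ℕ) : ℤ) : ℝ)| ≤ 2 := by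
    rw [show (k * (m + 1 : ℕ) : ℤ) = k * (m + 1 : ℕ) + c.2 - c.2 by ring, ← hk]
    exact abs_le.2 ⟨by linarith [hs'.1, ht'.2], by linarith [hs'.2, ht'.1]⟩
  norm_cast at h2
  rw [hk, Int.eq_zero_of_abs_lt_dvd (m := (m + 1 : ℕ)) (x := k * (m + 1 : ℕ) + c.2 - c.2)
    ⟨k, by ring⟩ (by rw [add_sub_cancel_right]; push_cast at h2 ⊢; omega)]
  simp

theorem productArc_zero (c : Piece × Fin (m + 1)) :
    productArc c 0 = annulusPoint (m + 1) (c.1.tl + 1) c.2 := by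
  rw [productArc, c.1.height_zero, c.1.angle_zero, add_zero]

theorem productArc_one (c : Piece × Fin (m + 1)) : productArc c 1 =
    annulusPoint (m + 1) (c.1.hd + 1) (c.1.next c.2) := by
  obtain ⟨k, hk⟩ := c.1.exists_next_eq c.2
  rw [productArc, c.1.height_one, hk, annulusPoint_add_mul]

theorem productArc_ne (c : Piece × Fin (m + 1)) {t : ℝ} (ht : t ∈ Set.Ioo (0 : ℝ) 1)
    (w : Fin 6 × Fin (m + 1)) : productArc c t ≠ annulusPoint (m + 1) (w.1 + 1) w.2 := by
  intro h
  obtain ⟨h1, k, hk⟩ := eq_of_annulusPoint_eq (c.1.height_pos ht.1.le) (by positivity) h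
  refine c.1.angle_ne_of_height_eq ht h1 (k * (m + 1 : ℕ) + w.2 - c.2) ?_
  push_cast at hk ⊢
  linarith

/-- The place in the cycle of the rail that a chord crosses. -/
def crossedPlace (x : Bool × Fin (m + 1)) : Fin (m + 1) := cond x.1 (x.2 - 1) x.2

theorem productArc_meets {c d : Piece × Fin (m + 1)} {s t : ℝ} (hs : s ∈ Set.Ioo (0 : ℝ) 1)
    (ht : t ∈ Set.Ioo (0 : ℝ) 1) (h : productArc c s = productArc d t) : c = d ∨
      ∃ x : Bool × Fin (m + 1),
        s(c, d) = s((.chord x.1, x.2), (.rail (cond x.1 4 3), crossedPlace x)) ∧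
        productArc c s = productArc (.chord x.1, x.2) (1 / 2) := by
  have place {i j : Fin (m + 1)} {k : ℤ} {b : Bool}
      (hk : k * (m + 1 : ℕ) + j - i = cond b (-1) 0) : j = crossedPlace (b, i) := by
    cases b
    · exact Fin.eq_of_sub_eq_mul (k := -k) (by
        simp only [cond_false] at hk
        simp only [crossedPlace, cond_false]
        linarith)
    · obtain ⟨l, hl⟩ := Fin.exists_add_one_eq j
      refine eq_sub_of_add_eq (Fin.eq_of_sub_eq_mul (k := l - k) ?_)
      simp only [cond_true] at hk
      rw [hl]
      push_cast at hk ⊢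
      linarith
  obtain ⟨h1, k, hk⟩ := productArc_eq hs.1.le ht.1.le h
  obtain ⟨a, i⟩ := c
  obtain ⟨b, j⟩ := d
  rcases Piece.meets hs ht h1 hk with ⟨rfl, hz⟩ | ⟨b, rfl, rfl, rfl, hz⟩ | ⟨b, rfl, rfl, rfl, hz⟩
  · exact .inl (Prod.ext rfl (Fin.eq_of_sub_eq_mul (k := k) (by dsimp only at hz ⊢; linarith)))
  · exact .inr ⟨(b, i), by rw [← place hz], rfl⟩
  · refine .inr ⟨(b, j), ?_, h⟩
    rw [Sym2.eq_swap, ← place (k := -k) (i := j) (j := i) (b := b) (hz ▸ by ring)]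

theorem exists_drawing (hm : 2 ≤ m) : ∃ D : Drawing (G6_63 □ cycleGraph (m + 1)),
    D.crossings.Finite ∧ D.crossings.ncard ≤ 2 * (m + 1) := by
  obtain ⟨edge, hs, he⟩ := exists_edge (m := m) (by omega)
  obtain ⟨code, hc⟩ := hs.hasRightInverse
  let D : Drawing (G6_63 □ cycleGraph (m + 1)) :=
    { vertexMap := fun w => annulusPoint (m + 1) (w.1 + 1) w.2
      vertexMap_injective := fun u v h => by
        obtain ⟨h1, k, hk⟩ := eq_of_annulusPoint_eq (by positivity) (by positivity) h
        exact Prod.ext (Fin.ext (by exact_mod_cast add_right_cancel h1))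
          (Fin.eq_of_sub_eq_mul (k := k) (by exact_mod_cast hk))
      arc := fun e => productArc (code e)
      arc_continuousOn := fun e => (continuous_productArc _).continuousOn
      arc_injOn := fun e => injOn_productArc hm _
      arc_endpoints := fun e => ⟨_, _, by rw [← he, hc], productArc_zero _, productArc_one _⟩
      arc_avoids_vertices := fun e t ht w => productArc_ne _ ht w }
  let F (x : Bool × Fin (m + 1)) : Sym2 (G6_63 □ cycleGraph (m + 1)).edgeSet × (ℝ × ℝ) :=
    (s(edge (.chord x.1, x.2), edge (.rail (cond x.1 4 3), crossedPlace x)),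
      productArc (.chord x.1, x.2) (1 / 2))
  have hF : D.crossings ⊆ F '' Set.univ := by
    rintro ⟨q, p⟩ ⟨e, f, hne, rfl, ⟨s, hs, hp⟩, t, ht, hp'⟩
    dsimp only at hp hp'
    rcases productArc_meets hs ht (hp.trans hp'.symm) with h | ⟨x, h1, h2⟩
    · exact absurd (by rw [← hc e, h, hc]) hne
    · refine ⟨x, trivial, Prod.ext ?_ (h2.symm.trans hp)⟩
      exact (congrArg (Sym2.map edge) h1).symm.trans
        (congrArg₂ (fun e f => s(e, f)) (hc e) (hc f))
  refine ⟨D, (Set.toFinite _).subset hF, (Set.ncard_le_ncard hF (Set.toFinite _)).trans <|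
    (Set.ncard_image_le (Set.toFinite _)).trans ?_⟩
  simp [Set.ncard_univ]

end ProductDrawing

/-- The crossing number of `G⁶₆₃ □ Cₙ` is `2n` for all `n ≥ 4`. -/
theorem crossingNumber_G6_63_boxProd_cycle (n : ℕ) (hn : 4 ≤ n) :
    crossingNumber (G6_63 □ SimpleGraph.cycleGraph n) = 2 * n := by
  obtain ⟨m, rfl⟩ := Nat.exists_eq_succ_of_ne_zero (show n ≠ 0 by omega)
  obtain ⟨D, hD, hle⟩ := exists_drawing (m := m) (by omega)
  obtain ⟨D', hD', h⟩ := Nat.sInf_mem (s := {k | ∃ D : Drawing (G6_63 □ cycleGraph (m + 1)),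
    D.crossings.Finite ∧ D.crossings.ncard = k}) ⟨_, D, hD, rfl⟩
  refine le_antisymm ?_ ((two_mul_le_ncard_crossings (by omega) D' hD').trans h.le)
  exact le_trans (Nat.sInf_le (m := D.crossings.ncard) ⟨D, hD, rfl⟩) hle
end

section
/- Let G be the simple graph on six vertices v1,...,v6 whose edges are the path edges v1v2, v2v3, v3v4, v4v5, v5v6 together with the chords v2v4 and v4v6 (this is the graph G^6_64 in Harary's enumeration of six-vertex graphs). Then for every integer n ≥ 6, the crossing number of the Cartesian product G □ C_n equals 2n. -/
open SimpleGraph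

/-- The graph `G⁶₆₄`: the path `v1 v2 v3 v4 v5 v6` together with the chords `v2v4` and `v4v6`. -/
def G6_64 : SimpleGraph (Fin 6) :=
  SimpleGraph.fromEdgeSet {s(0, 1), s(1, 2), s(2, 3), s(3, 4), s(4, 5), s(1, 3), s(3, 5)}

section HalfTurn

/-- The half turn of a curve `γ` about a point `p`: the quotient of the end value by the initial
value of a continuous square root of `γ - p`. -/
noncomputable def halfTurn (γ : ℝ → ℂ) (p : ℂ) : ℂ :=
  open Classical in
  if h : ∃ r : ℝ → ℂ, Continuous r ∧ (∀ t, r t ^ 2 = γ t - p) ∧ ∀ t, γ t ≠ p then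
    h.choose 1 / h.choose 0
  else 1

lemma exists_continuous_sq_eq {X : Type*} [TopologicalSpace X] [LocallyPathConnectedSpace X]
    [ContractibleSpace X] {g : X → ℂ} (hg : Continuous g) (h0 : ∀ x, g x ≠ 0) :
    ∃ r : X → ℂ, Continuous r ∧ ∀ x, r x ^ 2 = g x := by
  obtain ⟨r, hr, hr2⟩ := Complex.exists_continuousOn_pow_eq (X := X) (U := Set.univ)
    (have := (Homeomorph.Set.univ X).contractibleSpace; SimplyConnectedSpace.ofContractible _)
    isOpen_univ hg.continuousOn
    (by simpa using h0) two_ne_zero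
  exact ⟨r, continuousOn_univ.1 hr, hr2⟩

lemma continuous_sqrt_quotient_eq {r r' : ℝ → ℂ} (hr : Continuous r) (hr' : Continuous r')
    (h : ∀ t, r t ^ 2 = r' t ^ 2) (h0 : ∀ t, r t ≠ 0) (s t : ℝ) :
    r s / r t = r' s / r' t := by
  have h0' : ∀ t, r' t ≠ 0 := fun t ht => h0 t (by simpa [ht] using h t)
  rcases isPreconnected_univ.eq_or_eq_neg_of_sq_eq (f := r) (g := r') hr.continuousOn
    hr'.continuousOn (fun t _ => h t) (fun {t} _ => h0' t) with H | H
  · rw [H (Set.mem_univ s), H (Set.mem_univ t)]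
  · rw [H (Set.mem_univ s), H (Set.mem_univ t)]
    simp [neg_div_neg_eq]

lemma halfTurn_eq {γ : ℝ → ℂ} {p : ℂ} {r : ℝ → ℂ} (hr : Continuous r)
    (hr2 : ∀ t, r t ^ 2 = γ t - p) (hp : ∀ t, γ t ≠ p) : halfTurn γ p = r 1 / r 0 := by
  have h : ∃ r : ℝ → ℂ, Continuous r ∧ (∀ t, r t ^ 2 = γ t - p) ∧ ∀ t, γ t ≠ p :=
    ⟨r, hr, hr2, hp⟩
  rw [halfTurn, dif_pos h]
  refine continuous_sqrt_quotient_eq h.choose_spec.1 hr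
    (fun t => by rw [h.choose_spec.2.1, hr2]) (fun t ht => hp t ?_) 1 0
  have := h.choose_spec.2.1 t
  rw [ht] at this
  exact (sub_eq_zero.1 (by simpa using this.symm))

lemma halfTurn_sq {γ : ℝ → ℂ} {p : ℂ} (hγ : Continuous γ) (hp : ∀ t, γ t ≠ p) :
    halfTurn γ p ^ 2 = (γ 1 - p) / (γ 0 - p) := by
  obtain ⟨r, hr, hr2⟩ := exists_continuous_sq_eq (g := fun t => γ t - p) (by fun_prop)
    (fun t => sub_ne_zero.2 (hp t))
  rw [halfTurn_eq hr hr2 hp, div_pow, hr2, hr2]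

lemma halfTurn_ne_zero (γ : ℝ → ℂ) (p : ℂ) : halfTurn γ p ≠ 0 := by
  rw [halfTurn]
  split_ifs with h
  · have key : ∀ t, h.choose t ≠ 0 := fun t ht => h.choose_spec.2.2 t <| by
      have := h.choose_spec.2.1 t
      rw [ht] at this
      exact (sub_eq_zero.1 (by simpa using this.symm))
    exact div_ne_zero (key 1) (key 0)
  · exact one_ne_zero

lemma halfTurn_linking_eq_one {γ δ : ℝ → ℂ} (hγ : Continuous γ) (hδ : Continuous δ)
    (h : ∀ s t, γ s ≠ δ t) :
    halfTurn γ (δ 0) / halfTurn γ (δ 1) * (halfTurn δ (γ 1) / halfTurn δ (γ 0)) = 1 := by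
  obtain ⟨r, hr, hr2⟩ := exists_continuous_sq_eq (g := fun x : ℝ × ℝ => γ x.1 - δ x.2)
    (by fun_prop) (fun x => sub_ne_zero.2 (h _ _))
  have h0 : ∀ x, r x ≠ 0 := fun x hx => h x.1 x.2 <| by
    have := hr2 x
    rw [hx] at this
    exact (sub_eq_zero.1 (by simpa using this.symm))
  have hγt : ∀ t, halfTurn γ (δ t) = r (1, t) / r (0, t) := fun t =>
    halfTurn_eq (r := fun s => r (s, t)) (by fun_prop) (fun s => hr2 _) (fun s => h s t)
  have hδs : ∀ s, halfTurn δ (γ s) = r (s, 1) / r (s, 0) := fun s => by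
    rw [halfTurn_eq (r := fun t => Complex.I * r (s, t)) (by fun_prop)
      (fun t => by rw [mul_pow, hr2, Complex.I_sq]; ring) (fun t => (h s t).symm)]
    rw [mul_div_mul_left _ _ Complex.I_ne_zero]
  rw [hγt, hγt, hδs, hδs]
  field_simp [h0]

end HalfTurn

/-- A directed curve, remembered only through its endpoints and its half turns. -/
structure Track where
  src : ℂ
  tgt : ℂ
  turn : ℂ → ℂ
  turn_ne_zero : ∀ p, turn p ≠ 0

namespace Track

/-- Concatenation of tracks. -/
def trans (P Q : Track) : Track where
  src := P.src
  tgt := Q.tgt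
  turn p := P.turn p * Q.turn p
  turn_ne_zero p := mul_ne_zero (P.turn_ne_zero p) (Q.turn_ne_zero p)

/-- Reversal of a track. -/
noncomputable def symm (P : Track) : Track where
  src := P.tgt
  tgt := P.src
  turn p := (P.turn p)⁻¹
  turn_ne_zero p := inv_ne_zero (P.turn_ne_zero p)

/-- The sign recording the parity of the number of crossings of two tracks. -/
noncomputable def link (P Q : Track) : ℂ :=
  P.turn Q.src / P.turn Q.tgt * (Q.turn P.tgt / Q.turn P.src)

/-- A track is regular at `p` if its half turn about `p` squares to the correct value. -/
def RegularAt (P : Track) (p : ℂ) : Prop :=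
  P.turn p ^ 2 = (P.tgt - p) / (P.src - p)

lemma link_comm_eq_one {P Q : Track} (h : P.link Q = 1) : Q.link P = 1 := by
  have h1 := P.turn_ne_zero
  have h2 := Q.turn_ne_zero
  unfold link at *
  field_simp [h1, h2] at h ⊢
  exact h.symm

lemma link_trans {P P' Q : Track} (h : P.tgt = P'.src) (h1 : P.link Q = 1)
    (h2 : P'.link Q = 1) : (P.trans P').link Q = 1 := by
  have hP := P.turn_ne_zero
  have hP' := P'.turn_ne_zero
  have hQ := Q.turn_ne_zero
  have : (P.trans P').link Q = P.link Q * P'.link Q := by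
    simp only [link, trans, h]
    field_simp [hP, hP', hQ]
  rw [this, h1, h2, one_mul]

lemma link_symm {P Q : Track} (h : P.link Q = 1) : P.symm.link Q = 1 := by
  have hP := P.turn_ne_zero
  have hQ := Q.turn_ne_zero
  have : P.symm.link Q = (P.link Q)⁻¹ := by
    simp only [link, symm]
    field_simp [hP, hQ]
  rw [this, h, inv_one]

lemma RegularAt.trans {P Q : Track} {p : ℂ} (hP : P.RegularAt p) (hQ : Q.RegularAt p)
    (h : P.tgt = Q.src) (hp : P.tgt ≠ p) : (P.trans Q).RegularAt p := by
  have : Q.src - p ≠ 0 := sub_ne_zero.2 (h ▸ hp)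
  unfold RegularAt at *
  simp only [Track.trans, mul_pow, hP, hQ, h]
  field_simp

lemma RegularAt.symm {P : Track} {p : ℂ} (hP : P.RegularAt p) : P.symm.RegularAt p := by
  unfold RegularAt at *
  simp only [Track.symm, inv_pow, hP, inv_div]

/-- The three centres of a drawing of `K₃,₃` cannot be joined to the other three vertices by
pairwise unlinked tracks. -/
theorem exists_link_ne_one (c q : Fin 3 → ℂ) (hc : Function.Injective c)
    (hcq : ∀ i a, c i ≠ q a) (P : Fin 3 → Fin 3 → Track)
    (hs : ∀ i a, (P i a).src = c i) (ht : ∀ i a, (P i a).tgt = q a)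
    (hr : ∀ i a j, i ≠ j → (P i a).RegularAt (c j)) :
    ∃ i j a b, i < j ∧ a ≠ b ∧ (P i a).link (P j b) ≠ 1 := by
  by_contra! H
  let W : Fin 3 → ℂ := fun i =>
    ((P i 0).turn (q 1) * (P i 0).turn (q 2)) * ((P i 1).turn (q 0) * (P i 1).turn (q 2)) *
      ((P i 2).turn (q 0) * (P i 2).turn (q 1))
  let X : Fin 3 → ℂ := fun i => (q 0 - c i) * (q 1 - c i) * (q 2 - c i) * W i
  have hX : ∀ i, X i ≠ 0 := fun i => by
    have := fun a => sub_ne_zero.2 (hcq i a).symm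
    simp only [X, W, mul_ne_zero_iff]
    simp [this, Track.turn_ne_zero]
  have key : ∀ i j, i < j → X j = -X i := by
    intro i j hij
    have hne : c i - c j ≠ 0 := sub_ne_zero.2 (hc.ne hij.ne)
    have hne' : c j - c i ≠ 0 := sub_ne_zero.2 (hc.ne hij.ne')
    have e : ∀ a b, a ≠ b → (P i a).turn (c j) * (P j b).turn (q a) =
        (P i a).turn (q b) * (P j b).turn (c i) := by
      intro a b hab
      have h := H i j a b hij hab
      have h1 := (P i a).turn_ne_zero
      have h2 := (P j b).turn_ne_zero
      rw [link, hs, hs, ht, ht, div_mul_div_comm, div_eq_one_iff_eq (mul_ne_zero (h1 _) (h2 _))]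
        at h
      exact h
    have u : ∀ a, (P i a).turn (c j) ^ 2 * (c i - c j) = q a - c j := by
      intro a
      rw [hr i a j hij.ne, hs, ht, div_mul_cancel₀ _ hne]
    have v : ∀ a, (P j a).turn (c i) ^ 2 * (c j - c i) = q a - c i := by
      intro a
      rw [hr j a i hij.ne', hs, ht, div_mul_cancel₀ _ hne']
    have e01 := e 0 1 (by decide)
    have e02 := e 0 2 (by decide)
    have e10 := e 1 0 (by decide)
    have e12 := e 1 2 (by decide)
    have e20 := e 2 0 (by decide)
    have e21 := e 2 1 (by decide)
    have e' : ((P i 0).turn (c j) ^ 2 * (P i 1).turn (c j) ^ 2 * (P i 2).turn (c j) ^ 2) * W j =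
        ((P j 0).turn (c i) ^ 2 * (P j 1).turn (c i) ^ 2 * (P j 2).turn (c i) ^ 2) * W i := by
      calc _ = ((P i 0).turn (c j) * (P j 1).turn (q 0)) * ((P i 0).turn (c j) * (P j 2).turn (q 0))
            * ((P i 1).turn (c j) * (P j 0).turn (q 1)) * ((P i 1).turn (c j) * (P j 2).turn (q 1))
            * ((P i 2).turn (c j) * (P j 0).turn (q 2)) * ((P i 2).turn (c j) * (P j 1).turn (q 2))
            := by simp only [W]; ring
        _ = _ := by rw [e01, e02, e10, e12, e20, e21]; simp only [W]; ring
    simp only [X]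
    rw [← u 0, ← u 1, ← u 2, ← v 0, ← v 1, ← v 2]
    linear_combination (c i - c j) ^ 3 * e'
  have h01 := key 0 1 (by decide)
  have h02 := key 0 2 (by decide)
  have h12 := key 1 2 (by decide)
  apply hX 0
  linear_combination (1 / 2 : ℂ) * (h01 + h02 - h12)

end Track

section Curves

variable {V : Type*} {G : SimpleGraph V} (D : Drawing G)

/-- The position of a vertex in the complex plane. -/
noncomputable def Drawing.point_s3 (w : V) : ℂ := Complex.equivRealProdCLM.symm (D.vertexMap w)

lemma Drawing.point_injective : Function.Injective D.point_s3 :=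
  Complex.equivRealProdCLM.symm.injective.comp D.vertexMap_injective

lemma Drawing.exists_curve {u v : V} (h : G.Adj u v) :
    ∃ γ : ℝ → ℂ, Continuous γ ∧ γ 0 = D.point_s3 u ∧ γ 1 = D.point_s3 v ∧
      ∀ t, γ t = D.point_s3 u ∨ γ t = D.point_s3 v ∨
        ∃ s ∈ Set.Ioo (0 : ℝ) 1, γ t = Complex.equivRealProdCLM.symm (D.arc ⟨s(u, v), h⟩ s) := by
  set e : G.edgeSet := ⟨s(u, v), h⟩
  set δ : ℝ → ℂ := fun t =>
    Complex.equivRealProdCLM.symm (D.arc e (Set.projIcc 0 1 zero_le_one t))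
  have hδ : Continuous δ := by
    have := (D.arc_continuousOn e).domRestrict
    exact Complex.equivRealProdCLM.symm.continuous.comp (this.comp continuous_projIcc)
  obtain ⟨u', v', huv, h0, h1⟩ := D.arc_endpoints e
  have hδ0 : δ 0 = D.point_s3 u' := by simp [δ, Drawing.point_s3, h0]
  have hδ1 : δ 1 = D.point_s3 v' := by simp [δ, Drawing.point_s3, h1]
  have hδt : ∀ t, δ t = D.point_s3 u' ∨ δ t = D.point_s3 v' ∨
      ∃ s ∈ Set.Ioo (0 : ℝ) 1, δ t = Complex.equivRealProdCLM.symm (D.arc e s) := by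
    intro t
    obtain ⟨s, hs⟩ : ∃ s, s = Set.projIcc (0 : ℝ) 1 zero_le_one t := ⟨_, rfl⟩
    have hs' : δ t = Complex.equivRealProdCLM.symm (D.arc e s) := by simp only [δ, hs]
    rcases s.2.1.eq_or_lt with h | h
    · left
      rw [hs', ← h, h0, Drawing.point_s3]
    · rcases s.2.2.eq_or_lt with h' | h'
      · right; left
        rw [hs', h', h1, Drawing.point_s3]
      · exact .inr (.inr ⟨s, ⟨h, h'⟩, hs'⟩)
  rcases Sym2.eq_iff.1 huv with ⟨rfl, rfl⟩ | ⟨rfl, rfl⟩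
  · exact ⟨δ, hδ, hδ0, hδ1, hδt⟩
  · refine ⟨fun t => δ (1 - t), by fun_prop, by simpa using hδ1, by simpa using hδ0, fun t => ?_⟩
    rcases hδt (1 - t) with h | h | h
    exacts [.inr (.inl h), .inl h, .inr (.inr h)]

/-- A continuous curve along an edge of a drawing. -/
noncomputable def Drawing.curve {u v : V} (h : G.Adj u v) : ℝ → ℂ := (D.exists_curve h).choose

/-- The track along an edge of a drawing. -/
noncomputable def Drawing.track {u v : V} (h : G.Adj u v) : Track where
  src := D.point_s3 u
  tgt := D.point_s3 v
  turn := halfTurn (D.curve h)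
  turn_ne_zero := halfTurn_ne_zero _

lemma Drawing.track_regularAt {u v w : V} (h : G.Adj u v) (hu : u ≠ w) (hv : v ≠ w) :
    (D.track h).RegularAt (D.point_s3 w) := by
  obtain ⟨hc, h0, h1, ht⟩ := (D.exists_curve h).choose_spec
  have := halfTurn_sq (p := D.point_s3 w) hc (fun t hw => ?_)
  · rwa [h0, h1] at this
  · rcases ht t with h' | h' | ⟨s, hs, h'⟩
    · exact hu (D.point_injective (h'.symm.trans hw))
    · exact hv (D.point_injective (h'.symm.trans hw))
    · exact D.arc_avoids_vertices _ s hs w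
        (Complex.equivRealProdCLM.symm.injective (h'.symm.trans hw))

lemma Drawing.link_track_eq_one {u v u' v' : V} (h : G.Adj u v) (h' : G.Adj u' v')
    (h1 : u ≠ u') (h2 : u ≠ v') (h3 : v ≠ u') (h4 : v ≠ v')
    (hcr : ∀ p, (s(⟨s(u, v), h⟩, ⟨s(u', v'), h'⟩), p) ∉ D.crossings) :
    (D.track h).link (D.track h') = 1 := by
  obtain ⟨hc, h0, h1, ht⟩ := (D.exists_curve h).choose_spec
  obtain ⟨hc', h0', h1', ht'⟩ := (D.exists_curve h').choose_spec
  have key := halfTurn_linking_eq_one hc hc' fun s t hst => ?_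
  · rwa [h0, h1, h0', h1'] at key
  · have hinj := D.point_injective
    have hav := D.arc_avoids_vertices
    have hsym := Complex.equivRealProdCLM.symm.injective
    rcases ht s with e | e | ⟨x, hx, e⟩ <;> rcases ht' t with e' | e' | ⟨y, hy, e'⟩ <;>
      rw [e, e'] at hst
    · exact absurd (hinj hst) ‹_›
    · exact absurd (hinj hst) ‹_›
    · exact hav _ y hy _ (hsym hst.symm)
    · exact absurd (hinj hst) ‹_›
    · exact absurd (hinj hst) ‹_›
    · exact hav _ y hy _ (hsym hst.symm)
    · exact hav _ x hx _ (hsym hst)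
    · exact hav _ x hx _ (hsym hst)
    · refine hcr (D.arc ⟨s(u, v), h⟩ x) ⟨_, _, fun he => ?_, rfl, ⟨x, hx, rfl⟩,
        y, hy, (hsym hst).symm⟩
      rcases Sym2.eq_iff.1 (Subtype.ext_iff.1 he) with ⟨rfl, rfl⟩ | ⟨rfl, rfl⟩ <;> contradiction

end Curves

section Blocking

open Finset

/-- The left arm of a triple of layers `i < j`: the spoke `(false, i)` and the rails
`(true, x)` with `i ≤ x < j`. -/
def leftArm (i j : ℕ) : Finset (Bool × ℕ) :=
  insert (false, i) ((Ico i j).image (true, ·))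

/-- The right arm of a triple of layers `j < k`: the spoke `(false, k)` and the rails
`(true, x)` with `j ≤ x < k`. -/
def rightArm (j k : ℕ) : Finset (Bool × ℕ) :=
  insert (false, k) ((Ico j k).image (true, ·))

/-- Reduction of the layer modulo `m`. -/
def reduceSlot (m : ℕ) (u : Bool × ℕ) : Bool × ℕ := (u.1, u.2 % m)

/-- The pairs of slots lying on two different branches of the tripod on the layers
`i < j < k`. -/
def tripodPairs (m i j k : ℕ) : Finset (Sym2 (Bool × ℕ)) :=
  (leftArm i j ×ˢ {(false, j)} ∪ {(false, j)} ×ˢ rightArm j k ∪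
    leftArm i j ×ˢ rightArm j k).image fun p => s(reduceSlot m p.1, reduceSlot m p.2)

/-- A set of pairs of slots is blocking if it meets the pairs of every tripod. -/
def Blocking (m : ℕ) (E : Finset (Sym2 (Bool × ℕ))) : Prop :=
  ∀ i j k, i < j → j < k → k < i + m → ∃ e ∈ E, e ∈ tripodPairs m i j k

/-- The number of pairs in `E` that involve the spoke of layer `t`. -/
def spokeDegree (E : Finset (Sym2 (Bool × ℕ))) (t : ℕ) : ℕ :=
  (E.filter fun e => ((false, t) : Bool × ℕ) ∈ e).card

/-- The `x`-th layer that is not congruent to `m` modulo `m + 1`. -/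
def skipLayer (m x : ℕ) : ℕ := x / m * (m + 1) + x % m

/-- The number of the rail containing `z` after the layers congruent to `m` modulo `m + 1` have
been removed. -/
def mergeLayer (m z : ℕ) : ℕ := z / (m + 1) * m + min (z % (m + 1)) (m - 1)

lemma skipLayer_mod {m : ℕ} (hm : 0 < m) (x : ℕ) : skipLayer m x % (m + 1) = x % m := by
  have := Nat.mod_lt x hm
  rw [skipLayer, Nat.mul_add_mod', Nat.mod_eq_of_lt (by omega)]

lemma skipLayer_strictMono (m : ℕ) : StrictMono (skipLayer m) := by
  intro x y hxy
  have e : ∀ x, skipLayer m x = x + x / m := fun x => by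
    have := Nat.div_add_mod x m
    rw [skipLayer]
    linarith
  rw [e, e]
  have := Nat.div_le_div_right (c := m) hxy.le
  omega

lemma skipLayer_add {m : ℕ} (hm : 0 < m) (x : ℕ) :
    skipLayer m (x + m) = skipLayer m x + (m + 1) := by
  rw [skipLayer, skipLayer, Nat.add_div_right _ hm, Nat.add_mod_right]
  ring

lemma mergeLayer_mod {m : ℕ} (hm : 0 < m) (z : ℕ) :
    mergeLayer m z % m = min (z % (m + 1)) (m - 1) := by
  rw [mergeLayer, Nat.mul_add_mod', Nat.mod_eq_of_lt (by omega)]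

lemma le_mergeLayer {m : ℕ} (hm : 0 < m) {x z : ℕ} (h : skipLayer m x ≤ z) :
    x ≤ mergeLayer m z := by
  have hx := Nat.div_add_mod x m
  have hs := Nat.mod_lt x hm
  have hz := Nat.mod_lt z m.succ_pos
  have hz' := Nat.div_add_mod z (m + 1)
  rw [mergeLayer]
  rw [skipLayer] at h
  generalize x / m = q at *
  generalize x % m = s at *
  generalize z / (m + 1) = q' at *
  generalize z % (m + 1) = s' at *
  have hq : q ≤ q' := by
    by_contra hlt
    have : (q' + 1) * (m + 1) ≤ q * (m + 1) := Nat.mul_le_mul_right _ (by omega)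
    nlinarith
  rcases hq.eq_or_lt with rfl | hq
  · have : s ≤ s' := by nlinarith
    have : s ≤ min s' (m - 1) := by omega
    nlinarith
  · have : (q + 1) * m ≤ q' * m := Nat.mul_le_mul_right _ hq
    exact le_trans (by nlinarith : x ≤ q' * m) (Nat.le_add_right _ _)

lemma mergeLayer_lt {m : ℕ} (hm : 0 < m) {x z : ℕ} (h : z < skipLayer m x) :
    mergeLayer m z < x := by
  have hx := Nat.div_add_mod x m
  have hs := Nat.mod_lt x hm
  have hz := Nat.mod_lt z m.succ_pos
  have hz' := Nat.div_add_mod z (m + 1)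
  rw [mergeLayer]
  rw [skipLayer] at h
  generalize x / m = q at *
  generalize x % m = s at *
  generalize z / (m + 1) = q' at *
  generalize z % (m + 1) = s' at *
  have hq : q' ≤ q := by
    by_contra hlt
    have : (q + 1) * (m + 1) ≤ q' * (m + 1) := Nat.mul_le_mul_right _ (by omega)
    nlinarith
  rcases hq.eq_or_lt with rfl | hq
  · have : s' < s := by nlinarith
    have : min s' (m - 1) < s := by omega
    nlinarith
  · have : (q' + 1) * m ≤ q * m := Nat.mul_le_mul_right _ hq
    have : min s' (m - 1) < m := by omega
    nlinarith

/-- The relabelling of slots that removes layer `t` out of `m + 1` layers. -/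
def removeLayer (m t : ℕ) (u : Bool × ℕ) : Bool × ℕ :=
  (u.1, min ((u.2 + (m - t)) % (m + 1)) (m - 1))

lemma Blocking.remove {m : ℕ} (hm : 0 < m) {E : Finset (Sym2 (Bool × ℕ))}
    (hE : Blocking (m + 1) E) {t : ℕ} (ht : t < m + 1) :
    ∃ E', Blocking m E' ∧ E'.card + spokeDegree E t ≤ E.card := by
  have hlift : ∀ z, ((z + t + 1) % (m + 1) + (m - t)) % (m + 1) = z % (m + 1) := fun z => by
    rw [Nat.mod_add_mod, show z + t + 1 + (m - t) = z + (m + 1) by omega, Nat.add_mod_right]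
  have hspoke : ∀ x, removeLayer m t (reduceSlot (m + 1) (false, skipLayer m x + t + 1)) =
      reduceSlot m (false, x) := fun x => by
    have := Nat.mod_lt x hm
    simp only [removeLayer, reduceSlot, hlift, skipLayer_mod hm, Prod.mk.injEq, true_and]
    omega
  have hspoke' : ∀ x, reduceSlot (m + 1) (false, skipLayer m x + t + 1) ≠ (false, t) := by
    intro x hx
    have h1 := hlift (skipLayer m x)
    have h2 := Nat.mod_lt x hm
    have h3 : (skipLayer m x + t + 1) % (m + 1) = t := (Prod.ext_iff.1 hx).2
    rw [h3, skipLayer_mod hm, show t + (m - t) = m by omega, Nat.mod_eq_of_lt (by omega)] at h1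
    omega
  have harc : ∀ x y z, z ∈ Ico (skipLayer m x + t + 1) (skipLayer m y + t + 1) →
      ∃ w ∈ Ico x y, removeLayer m t (reduceSlot (m + 1) (true, z)) = reduceSlot m (true, w) := by
    intro x y z hz
    rw [mem_Ico] at hz
    obtain ⟨z, rfl⟩ : ∃ z', z = z' + t + 1 := ⟨z - t - 1, by omega⟩
    refine ⟨mergeLayer m z, mem_Ico.2 ⟨le_mergeLayer hm (by omega), mergeLayer_lt hm (by omega)⟩,
      ?_⟩
    simp only [removeLayer, reduceSlot, hlift, mergeLayer_mod hm]
  have hleft : ∀ x y, ∀ u ∈ leftArm (skipLayer m x + t + 1) (skipLayer m y + t + 1),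
      reduceSlot (m + 1) u ≠ (false, t) ∧ ∃ v ∈ leftArm x y,
        removeLayer m t (reduceSlot (m + 1) u) = reduceSlot m v := by
    intro x y u hu
    rcases mem_insert.1 hu with rfl | hu
    · exact ⟨hspoke' x, _, mem_insert_self _ _, hspoke x⟩
    · obtain ⟨z, hz, rfl⟩ := mem_image.1 hu
      obtain ⟨w, hw, hw'⟩ := harc x y z hz
      exact ⟨by simp [reduceSlot], _, mem_insert_of_mem (mem_image_of_mem _ hw), hw'⟩
  have hright : ∀ x y, ∀ u ∈ rightArm (skipLayer m x + t + 1) (skipLayer m y + t + 1),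
      reduceSlot (m + 1) u ≠ (false, t) ∧ ∃ v ∈ rightArm x y,
        removeLayer m t (reduceSlot (m + 1) u) = reduceSlot m v := by
    intro x y u hu
    rcases mem_insert.1 hu with rfl | hu
    · exact ⟨hspoke' y, _, mem_insert_self _ _, hspoke y⟩
    · obtain ⟨z, hz, rfl⟩ := mem_image.1 hu
      obtain ⟨w, hw, hw'⟩ := harc x y z hz
      exact ⟨by simp [reduceSlot], _, mem_insert_of_mem (mem_image_of_mem _ hw), hw'⟩
  refine ⟨(E.filter fun e => ((false, t) : Bool × ℕ) ∉ e).image (Sym2.map (removeLayer m t)),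
    ?_, ?_⟩
  · intro i j k hij hjk hki
    have hmono := skipLayer_strictMono m
    have hki' := hmono hki
    rw [skipLayer_add hm] at hki'
    obtain ⟨e, he, he'⟩ := hE (skipLayer m i + t + 1) (skipLayer m j + t + 1)
      (skipLayer m k + t + 1) (by have := hmono hij; omega) (by have := hmono hjk; omega)
      (by omega)
    obtain ⟨⟨u, v⟩, huv, rfl⟩ := mem_image.1 he'
    have hmid : ∀ v ∈ ({(false, skipLayer m j + t + 1)} : Finset (Bool × ℕ)),
        reduceSlot (m + 1) v ≠ (false, t) ∧ ∃ w ∈ ({(false, j)} : Finset (Bool × ℕ)),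
          removeLayer m t (reduceSlot (m + 1) v) = reduceSlot m w := by
      intro v hv
      rw [mem_singleton.1 hv]
      exact ⟨hspoke' j, _, mem_singleton_self _, hspoke j⟩
    have main : ∀ A B : Finset (Bool × ℕ), A ×ˢ B ⊆ leftArm i j ×ˢ {(false, j)} ∪
        {(false, j)} ×ˢ rightArm j k ∪ leftArm i j ×ˢ rightArm j k →
        (reduceSlot (m + 1) u ≠ (false, t) ∧ ∃ w ∈ A,
          removeLayer m t (reduceSlot (m + 1) u) = reduceSlot m w) →
        (reduceSlot (m + 1) v ≠ (false, t) ∧ ∃ w ∈ B,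
          removeLayer m t (reduceSlot (m + 1) v) = reduceSlot m w) →
        ∃ e ∈ (E.filter fun e => ((false, t) : Bool × ℕ) ∉ e).image
          (Sym2.map (removeLayer m t)), e ∈ tripodPairs m i j k := by
      rintro A B hAB ⟨hu, u', hu', hu''⟩ ⟨hv, v', hv', hv''⟩
      refine ⟨_, mem_image_of_mem _ (mem_filter.2 ⟨he, ?_⟩), ?_⟩
      · rw [Sym2.mem_iff]
        rintro (h | h)
        · exact hu h.symm
        · exact hv h.symm
      · rw [Sym2.map_mk, hu'', hv'']
        exact mem_image_of_mem (fun p : (Bool × ℕ) × (Bool × ℕ) =>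
          s(reduceSlot m p.1, reduceSlot m p.2)) (hAB (mk_mem_product hu' hv'))
    simp only [mem_union, mem_product] at huv
    rcases huv with (⟨hu, hv⟩ | ⟨hu, hv⟩) | ⟨hu, hv⟩
    · exact main _ _ (by grind) (hleft _ _ _ hu) (hmid _ hv)
    · exact main _ _ (by grind) (hmid _ hu) (hright _ _ _ hv)
    · exact main _ _ (by grind) (hleft _ _ _ hu) (hright _ _ _ hv)
  · rw [spokeDegree, ← card_filter_add_card_filter_not (s := E)
      (fun e => ((false, t) : Bool × ℕ) ∈ e), add_comm]
    exact Nat.add_le_add_left card_image_le _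

lemma Blocking.le_card_of_spokeDegree_eq_zero {m : ℕ} (hm : 3 ≤ m)
    {E : Finset (Sym2 (Bool × ℕ))} (hE : Blocking m E) (h : ∀ t < m, spokeDegree E t = 0) :
    m ≤ E.card := by
  have hno : ∀ e ∈ E, ∀ t < m, ((false, t) : Bool × ℕ) ∉ e := fun e he t ht hte => by
    have := h t ht
    rw [spokeDegree, card_eq_zero, filter_eq_empty_iff] at this
    exact this he hte
  have key : ∀ t ∈ range m,
      s(((true, t) : Bool × ℕ), (true, (t + 1) % m)) ∈ E := by
    intro t ht
    obtain ⟨e, he, he'⟩ := hE t (t + 1) (t + 2) (by omega) (by omega) (by omega)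
    obtain ⟨⟨u, v⟩, huv, rfl⟩ := mem_image.1 he'
    have hu : u.1 = true := by
      by_contra hu
      exact hno _ he (u.2 % m) (Nat.mod_lt _ (by omega)) (by simp [reduceSlot, hu])
    have hv : v.1 = true := by
      by_contra hv
      exact hno _ he (v.2 % m) (Nat.mod_lt _ (by omega)) (by simp [reduceSlot, hv])
    have hu' : u = (true, t) := by
      simp only [leftArm, rightArm, mem_union, mem_product, mem_insert, mem_image, mem_Ico,
        mem_singleton] at huv
      grind
    have hv' : v = (true, t + 1) := by
      simp only [leftArm, rightArm, mem_union, mem_product, mem_insert, mem_image, mem_Ico,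
        mem_singleton] at huv
      grind
    simpa [hu', hv', reduceSlot, Nat.mod_eq_of_lt (mem_range.1 ht)] using he
  calc m = (range m).card := (card_range m).symm
    _ ≤ E.card := card_le_card_of_injOn _ key ?_
  intro t ht t' ht' htt
  simp only [coe_range, Set.mem_Iio] at ht ht'
  simp only [Sym2.eq_iff, Prod.mk.injEq, true_and] at htt
  rcases htt with h | ⟨h1, h2⟩
  · exact h.1
  · have e1 : ∀ x < m, (x + 1) % m = x + 1 ∨ ((x + 1) % m = 0 ∧ x + 1 = m) := fun x hx => by
      rcases (Nat.succ_le_of_lt hx).lt_or_eq with h | h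
      · exact Or.inl (Nat.mod_eq_of_lt h)
      · exact Or.inr ⟨by rw [← h]; exact Nat.mod_self _, h⟩
    have := e1 t ht
    have := e1 t' ht'
    omega

/-- The weight of a pair in a weighted sum of tripods that is invariant under rotation. -/
def tripodWeight (m a b c d : ℕ) (e : Sym2 (Bool × ℕ)) : ℕ :=
  ∑ t ∈ range m,
    ((if e ∈ tripodPairs m t (t + 1) (t + 2) then a else 0) +
      (if e ∈ tripodPairs m t (t + 1) (t + 3) then b else 0) +
      (if e ∈ tripodPairs m t (t + 2) (t + 3) then c else 0) +
      (if e ∈ tripodPairs m t (t + 2) (t + 4) then d else 0))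

lemma tripodPairs_subset {m : ℕ} (hm : 0 < m) (i j k : ℕ) :
    tripodPairs m i j k ⊆ (univ ×ˢ range m).sym2 := by
  intro e he
  obtain ⟨⟨u, v⟩, -, rfl⟩ := mem_image.1 he
  simp [reduceSlot, Nat.mod_lt _ hm]

lemma Blocking.weighted {m : ℕ} (hm : 4 < m) {E : Finset (Sym2 (Bool × ℕ))}
    (hE : Blocking m E) (h : ∀ t < m, spokeDegree E t ≤ 1) {a b c d K L : ℕ}
    (hw : ∀ u ∈ univ ×ˢ range m, ∀ v ∈ univ ×ˢ range m, tripodWeight m a b c d s(u, v) ≤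
      K + L * ∑ t ∈ range m, if ((false, t) : Bool × ℕ) ∈ s(u, v) then 1 else 0) :
    m * (a + b + c + d) ≤ K * E.card + L * m := by
  have hw' : ∀ e, tripodWeight m a b c d e ≤
      K + L * ∑ t ∈ range m, if ((false, t) : Bool × ℕ) ∈ e then 1 else 0 := by
    intro e
    by_cases he : e ∈ (univ ×ˢ range m).sym2
    · induction e with | _ u v =>
      rw [mk_mem_sym2_iff] at he
      exact hw u he.1 v he.2
    · have : ∀ i j k, e ∉ tripodPairs m i j k := fun i j k h' =>
        he (tripodPairs_subset (by omega) i j k h')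
      simp [tripodWeight, this]
  have hpos : ∀ i j k x, i < j → j < k → k < i + m →
      x ≤ ∑ e ∈ E, if e ∈ tripodPairs m i j k then x else 0 := by
    intro i j k x hij hjk hki
    obtain ⟨e, he, he'⟩ := hE i j k hij hjk hki
    calc x = if e ∈ tripodPairs m i j k then x else 0 := by rw [if_pos he']
      _ ≤ _ := single_le_sum (f := fun e => if e ∈ tripodPairs m i j k then x else 0)
        (fun _ _ => Nat.zero_le _) he
  calc m * (a + b + c + d) = ∑ t ∈ range m, (a + b + c + d) := by simp
    _ ≤ ∑ t ∈ range m, ∑ e ∈ E,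
        ((if e ∈ tripodPairs m t (t + 1) (t + 2) then a else 0) +
          (if e ∈ tripodPairs m t (t + 1) (t + 3) then b else 0) +
          (if e ∈ tripodPairs m t (t + 2) (t + 3) then c else 0) +
          (if e ∈ tripodPairs m t (t + 2) (t + 4) then d else 0)) := by
      refine sum_le_sum fun t _ => ?_
      simp only [sum_add_distrib]
      gcongr <;> exact hpos _ _ _ _ (by omega) (by omega) (by omega)
    _ = ∑ e ∈ E, tripodWeight m a b c d e := sum_comm
    _ ≤ ∑ e ∈ E, (K + L * ∑ t ∈ range m, if ((false, t) : Bool × ℕ) ∈ e then 1 else 0) :=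
      sum_le_sum fun e _ => hw' e
    _ = K * E.card + L * ∑ t ∈ range m, spokeDegree E t := by
      simp only [spokeDegree, card_filter]
      rw [sum_add_distrib, sum_const, smul_eq_mul, mul_comm, ← mul_sum, sum_comm]
    _ ≤ K * E.card + L * m := by
      gcongr
      calc ∑ t ∈ range m, spokeDegree E t ≤ ∑ t ∈ range m, 1 :=
            sum_le_sum fun t ht => h t (mem_range.1 ht)
        _ = m := by simp

lemma Blocking.four_le_card_of_spokeDegree_le_one {E : Finset (Sym2 (Bool × ℕ))}
    (hE : Blocking 5 E) (h : ∀ t < 5, spokeDegree E t ≤ 1) : 4 ≤ E.card := by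
  have := hE.weighted (by norm_num) h (a := 4) (b := 3) (c := 1) (d := 0) (K := 8) (L := 2)
    (by decide +kernel)
  omega

lemma Blocking.six_le_card_of_spokeDegree_le_one {E : Finset (Sym2 (Bool × ℕ))}
    (hE : Blocking 6 E) (h : ∀ t < 6, spokeDegree E t ≤ 1) : 6 ≤ E.card := by
  have := hE.weighted (by norm_num) h (a := 6) (b := 7) (c := 5) (d := 2) (K := 20) (L := 2)
    (by decide +kernel)
  omega

lemma Blocking.two_le_card {E : Finset (Sym2 (Bool × ℕ))} (hE : Blocking 4 E) : 2 ≤ E.card := by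
  by_cases h : ∃ t < 4, 1 ≤ spokeDegree E t
  · obtain ⟨t, ht, hd⟩ := h
    obtain ⟨E', hE', hc⟩ := Blocking.remove (m := 3) (by norm_num) hE ht
    obtain ⟨e, he, -⟩ := hE' 0 1 2 (by norm_num) (by norm_num) (by norm_num)
    have := Finset.card_pos.2 ⟨e, he⟩
    omega
  · push Not at h
    have := hE.le_card_of_spokeDegree_eq_zero (by norm_num) fun t ht => by
      have := h t ht
      omega
    omega

lemma Blocking.four_le_card {E : Finset (Sym2 (Bool × ℕ))} (hE : Blocking 5 E) :
    4 ≤ E.card := by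
  by_cases h : ∃ t < 5, 2 ≤ spokeDegree E t
  · obtain ⟨t, ht, hd⟩ := h
    obtain ⟨E', hE', hc⟩ := Blocking.remove (m := 4) (by norm_num) hE ht
    have := hE'.two_le_card
    omega
  · push Not at h
    exact hE.four_le_card_of_spokeDegree_le_one fun t ht => Nat.le_of_lt_succ (h t ht)

/-- A blocking set on at least six layers has at least as many pairs as there are layers. -/
theorem Blocking.le_card {m : ℕ} (hm : 6 ≤ m) {E : Finset (Sym2 (Bool × ℕ))}
    (hE : Blocking m E) : m ≤ E.card := by
  induction m, hm using Nat.le_induction generalizing E with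
  | base =>
    by_cases h : ∃ t < 6, 2 ≤ spokeDegree E t
    · obtain ⟨t, ht, hd⟩ := h
      obtain ⟨E', hE', hc⟩ := Blocking.remove (m := 5) (by norm_num) hE ht
      have := hE'.four_le_card
      omega
    · push Not at h
      exact hE.six_le_card_of_spokeDegree_le_one fun t ht => Nat.le_of_lt_succ (h t ht)
  | succ m hm ih =>
    by_cases h : ∃ t < m + 1, 1 ≤ spokeDegree E t
    · obtain ⟨t, ht, hd⟩ := h
      obtain ⟨E', hE', hc⟩ := Blocking.remove (by omega) hE ht
      have := ih hE'
      omega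
    · push Not at h
      exact hE.le_card_of_spokeDegree_eq_zero (by omega) fun t ht => by
        have := h t ht
        omega

end Blocking

section Slots

open Finset

variable {V : Type*} {G : SimpleGraph V} {c : V} {n : ℕ}

/-- The source of the edge of `G □ Cₙ` belonging to the leaf `a` of the star with centre `c`: a
rail starts in the copy of the leaf, a spoke in the copy of the centre. -/
def slotSrc (c a : V) (u : Bool × Fin (n + 3)) : V × Fin (n + 3) := (bif u.1 then a else c, u.2)

/-- The target of the edge of `G □ Cₙ` belonging to the leaf `a`. -/
def slotTgt (a : V) (u : Bool × Fin (n + 3)) : V × Fin (n + 3) :=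
  (a, bif u.1 then u.2 + 1 else u.2)

lemma adj_slotSrc_slotTgt {a : V} (h : G.Adj c a) (u : Bool × Fin (n + 3)) :
    (G □ cycleGraph (n + 3)).Adj (slotSrc c a u) (slotTgt a u) := by
  rcases u with ⟨_ | _, t⟩
  · simpa [slotSrc, slotTgt, boxProd_adj] using h
  · simp [slotSrc, slotTgt, boxProd_adj, cycleGraph_adj]

/-- The edge of `G □ Cₙ` in the slot `x.2` of the leaf `x.1`. -/
def slotEdge (x : {a // G.Adj c a} × (Bool × Fin (n + 3))) : (G □ cycleGraph (n + 3)).edgeSet :=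
  ⟨s(slotSrc c x.1 x.2, slotTgt x.1 x.2), adj_slotSrc_slotTgt x.1.2 x.2⟩

lemma add_one_add_one_ne (t : Fin (n + 3)) : t + 1 + 1 ≠ t := by
  rw [add_assoc, ne_eq, add_eq_left]
  exact Fin.ne_of_val_ne (by simp [Fin.val_add, Nat.mod_eq_of_lt])

lemma slotEdge_injective :
    Function.Injective (slotEdge (G := G) (c := c) (n := n)) := by
  rintro ⟨⟨a, ha⟩, u, t⟩ ⟨⟨a', ha'⟩, u', t'⟩ h
  have h := Subtype.ext_iff.1 h
  have hne := ha.ne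
  have hne' := ha'.ne
  have htt := add_one_add_one_ne t
  rcases u <;> rcases u' <;>
    simp only [slotEdge, slotSrc, slotTgt, Sym2.eq_iff, Prod.mk.injEq, cond_true, cond_false] at h
      <;> grind

/-- The slot of the layer with number `u.2`. -/
def slotMod (n : ℕ) (u : Bool × ℕ) : Bool × Fin (n + 3) := (u.1, Fin.ofNat (n + 3) u.2)

lemma ofNat_add_one (t : ℕ) : Fin.ofNat (n + 3) (t + 1) = Fin.ofNat (n + 3) t + 1 := by
  ext
  simp [Fin.val_add, Nat.add_mod]

lemma ofNat_ne {s t : ℕ} (h : s < t) (h' : t < s + (n + 3)) :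
    Fin.ofNat (n + 3) s ≠ Fin.ofNat (n + 3) t := by
  intro he
  have := (Nat.modEq_iff_dvd' h.le).1 (Fin.val_eq_of_eq he : s % (n + 3) = t % (n + 3))
  have := Nat.le_of_dvd (by omega) this
  omega

variable (D : Drawing (G □ cycleGraph (n + 3)))

/-- The position of the copy of the vertex `a` in the layer with number `t`. -/
noncomputable def Drawing.layerPoint (a : V) (t : ℕ) : ℂ := D.point_s3 (a, Fin.ofNat (n + 3) t)

/-- The track along the edge in a slot of a leaf. -/
noncomputable def Drawing.slotTrack {a : V} (h : G.Adj c a) (u : Bool × ℕ) : Track :=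
  D.track (adj_slotSrc_slotTgt h (slotMod n u))

variable {D}

/-- There is a track from the copy of the centre in layer `t` to the copy of the leaf in layer `j`
that runs only through the slots in `A`. -/
def Drawing.ArmTrack (D : Drawing (G □ cycleGraph (n + 3))) {a : V} (h : G.Adj c a)
    (A : Finset (Bool × ℕ)) (t j : ℕ) (P : Track) : Prop :=
  P.src = D.layerPoint c t ∧ P.tgt = D.layerPoint a j ∧
    (∀ s, Fin.ofNat (n + 3) t ≠ Fin.ofNat (n + 3) s → P.RegularAt (D.layerPoint c s)) ∧
    ∀ Q, (∀ u ∈ A, (D.slotTrack h u).link Q = 1) → P.link Q = 1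

lemma armTrack_spoke {a : V} (h : G.Adj c a) (t : ℕ) :
    D.ArmTrack h {(false, t)} t t (D.slotTrack h (false, t)) := by
  refine ⟨rfl, rfl, fun s hs => ?_, fun Q hQ => hQ _ (mem_singleton_self _)⟩
  refine D.track_regularAt _ ?_ ?_
  · simpa [slotSrc, slotMod, Prod.ext_iff] using hs
  · simp [slotTgt, Prod.ext_iff, h.ne']

lemma rail_regularAt {a : V} (h : G.Adj c a) (x s : ℕ) :
    (D.slotTrack h (true, x)).RegularAt (D.layerPoint c s) := by
  refine D.track_regularAt _ ?_ ?_ <;> simp [slotSrc, slotTgt, Prod.ext_iff, slotMod, h.ne']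

lemma rail_tgt {a : V} (h : G.Adj c a) (x : ℕ) :
    (D.slotTrack h (true, x)).tgt = D.layerPoint a (x + 1) := by
  rw [Drawing.layerPoint, ofNat_add_one]
  rfl

lemma layerPoint_ne {a : V} (h : G.Adj c a) (x s : ℕ) :
    D.layerPoint a x ≠ D.layerPoint c s :=
  D.point_injective.ne (by simp [Prod.ext_iff, h.ne'])

lemma exists_armTrack_left {a : V} (h : G.Adj c a) {i j : ℕ} (hij : i ≤ j) :
    ∃ P, D.ArmTrack h (leftArm i j) i j P := by
  induction j, hij using Nat.le_induction with
  | base => exact ⟨_, by simpa [leftArm] using armTrack_spoke h i⟩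
  | succ j hij ih =>
    obtain ⟨P, hs, ht, hr, hl⟩ := ih
    have e : P.tgt = (D.slotTrack h (true, j)).src := ht
    refine ⟨P.trans (D.slotTrack h (true, j)), hs, rail_tgt h j,
      fun s hs => (hr s hs).trans (rail_regularAt h j s) e (ht ▸ layerPoint_ne h j s),
      fun Q hQ => Track.link_trans e (hl Q fun u hu => hQ u ?_) (hQ _ ?_)⟩
    · simp only [leftArm, mem_insert, mem_image, mem_Ico] at hu ⊢
      rcases hu with hu | ⟨x, hx, hu⟩
      · exact .inl hu
      · exact .inr ⟨x, by omega, hu⟩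
    · simp [leftArm, hij]

lemma exists_armTrack_right {a : V} (h : G.Adj c a) {j k : ℕ} (hjk : j ≤ k) :
    ∃ P, D.ArmTrack h (rightArm j k) k j P := by
  induction hjk using Nat.decreasingInduction with
  | self => exact ⟨_, by simpa [rightArm] using armTrack_spoke h k⟩
  | of_succ j hjk ih =>
    obtain ⟨P, hs, ht, hr, hl⟩ := ih
    have e : P.tgt = (D.slotTrack h (true, j)).symm.src := ht.trans (rail_tgt h j).symm
    refine ⟨P.trans (D.slotTrack h (true, j)).symm, hs, rfl,
      fun s hs => (hr s hs).trans (rail_regularAt h j s).symm e (ht ▸ layerPoint_ne h _ s),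
      fun Q hQ => Track.link_trans e (hl Q fun u hu => hQ u ?_) (Track.link_symm (hQ _ ?_))⟩
    · simp only [rightArm, mem_insert, mem_image, mem_Ico] at hu ⊢
      rcases hu with hu | ⟨x, hx, hu⟩
      · exact .inl hu
      · exact .inr ⟨x, by omega, hu⟩
    · simp [rightArm, hjk]

lemma exists_crossing_of_link_ne_one {a b : V} (ha : G.Adj c a) (hb : G.Adj c b) (hab : a ≠ b)
    {u v : Bool × ℕ} (huv : u.1 = true ∨ v.1 = true ∨ (slotMod n u).2 ≠ (slotMod n v).2)
    (h : (D.slotTrack ha u).link (D.slotTrack hb v) ≠ 1) :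
    ∃ p, (s(slotEdge (⟨a, ha⟩, slotMod n u), slotEdge (⟨b, hb⟩, slotMod n v)), p) ∈
      D.crossings := by
  by_contra! hcr
  refine h (D.link_track_eq_one _ _ ?_ ?_ ?_ ?_ hcr)
  · rcases u with ⟨_ | _, u⟩ <;> rcases v with ⟨_ | _, v⟩ <;>
      simp_all [slotSrc, slotMod, Prod.ext_iff, ha.ne', hb.ne]
  · rcases u with ⟨_ | _, u⟩ <;> simp [slotSrc, slotTgt, slotMod, hab, hb.ne]
  · rcases v with ⟨_ | _, v⟩ <;> simp [slotSrc, slotTgt, slotMod, ha.ne', hab]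
  · simp [slotTgt, hab]

/-- The tripod of three leaves on three layers contains a crossing. -/
lemma exists_crossing_mem_tripodPairs (T : Fin 3 → {a // G.Adj c a}) (hT : Function.Injective T)
    {i j k : ℕ} (hij : i < j) (hjk : j < k) (hki : k < i + (n + 3)) :
    ∃ a b u v, a ≠ b ∧ s(reduceSlot (n + 3) u, reduceSlot (n + 3) v) ∈ tripodPairs (n + 3) i j k ∧
      ∃ p, (s(slotEdge (T a, slotMod n u), slotEdge (T b, slotMod n v)), p) ∈ D.crossings := by
  let L : Fin 3 → ℕ := ![i, j, k]
  let A : Fin 3 → Finset (Bool × ℕ) := ![leftArm i j, {(false, j)}, rightArm j k]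
  have hL : ∀ x y, x < y → Fin.ofNat (n + 3) (L x) ≠ Fin.ofNat (n + 3) (L y) := by
    intro x y hxy
    fin_cases x <;> fin_cases y <;> first | exact absurd hxy (by decide) | skip
    · exact ofNat_ne hij (show j < i + (n + 3) by omega)
    · exact ofNat_ne (hij.trans hjk) hki
    · exact ofNat_ne hjk (show k < j + (n + 3) by omega)
  have hL' : ∀ x y, x ≠ y → Fin.ofNat (n + 3) (L x) ≠ Fin.ofNat (n + 3) (L y) := fun x y hxy =>
    hxy.lt_or_gt.elim (hL x y) fun h => (hL y x h).symm
  have hA : ∀ x, ∀ u ∈ A x, u.1 = true ∨ u.2 = L x := by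
    intro x u hu
    fin_cases x <;> simp [A, L, leftArm, rightArm] at hu ⊢ <;> grind
  have hpairs : ∀ x y, x < y → ∀ u ∈ A x, ∀ v ∈ A y,
      s(reduceSlot (n + 3) u, reduceSlot (n + 3) v) ∈ tripodPairs (n + 3) i j k := by
    intro x y hxy u hu v hv
    refine mem_image.2 ⟨(u, v), ?_, rfl⟩
    simp only [mem_union, mem_product]
    fin_cases x <;> fin_cases y <;> first | exact absurd hxy (by decide) | skip
    · exact .inl (.inl ⟨hu, hv⟩)
    · exact .inr ⟨hu, hv⟩
    · exact .inl (.inr ⟨hu, hv⟩)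
  have hP : ∀ x a, ∃ P, D.ArmTrack (T a).2 (A x) (L x) j P := by
    intro x a
    fin_cases x
    · exact exists_armTrack_left _ hij.le
    · exact ⟨_, armTrack_spoke _ j⟩
    · exact exists_armTrack_right _ hjk.le
  choose P hs ht hr hl using hP
  obtain ⟨x, y, a, b, hxy, hab, hlink⟩ := Track.exists_link_ne_one
    (fun x => D.layerPoint c (L x)) (fun a => D.layerPoint (T a) j)
    (fun x y hxy => by
      by_contra hne
      exact hL' x y hne (Prod.ext_iff.1 (D.point_injective hxy)).2)
    (fun x a => (layerPoint_ne (T a).2 j (L x)).symm) P hs ht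
    (fun x a y hxy => hr x a _ (hL' x y hxy))
  obtain ⟨u, hu, hlink⟩ : ∃ u ∈ A x, (D.slotTrack (T a).2 u).link (P y b) ≠ 1 := by
    by_contra! H
    exact hlink (hl x a _ H)
  obtain ⟨v, hv, hlink⟩ :
      ∃ v ∈ A y, (D.slotTrack (T b).2 v).link (D.slotTrack (T a).2 u) ≠ 1 := by
    by_contra! H
    exact hlink (Track.link_comm_eq_one (hl y b _ H))
  refine ⟨a, b, u, v, hab, hpairs x y hxy u hu v hv, exists_crossing_of_link_ne_one (T a).2 (T b).2
    (Subtype.coe_injective.ne (hT.ne hab)) ?_ fun h => hlink (Track.link_comm_eq_one h)⟩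
  rcases hA x u hu with h | h
  · exact .inl h
  rcases hA y v hv with h' | h'
  · exact .inr (.inl h')
  · simpa only [slotMod, h, h'] using .inr (.inr (hL x y hxy))

/-- If `G` has a vertex of degree four, then every drawing of `G □ Cₙ` has at least `2n`
crossings. -/
theorem two_mul_le_ncard_crossings_s3 (hn : 3 ≤ n) [Fintype {a // G.Adj c a}]
    (hdeg : Fintype.card {a // G.Adj c a} = 4) (D : Drawing (G □ cycleGraph (n + 3)))
    (hD : D.crossings.Finite) : 2 * (n + 3) ≤ D.crossings.ncard := by
  classical
  let K : Finset (Sym2 ({a // G.Adj c a} × (Bool × Fin (n + 3)))) :=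
    univ.filter fun κ => ∃ p, (κ.map slotEdge, p) ∈ D.crossings
  have hK : K.card ≤ D.crossings.ncard := by
    rw [← Set.ncard_coe_finset,
      ← Set.ncard_image_of_injective _ (Sym2.map.injective slotEdge_injective)]
    refine (Set.ncard_le_ncard ?_ (hD.image Prod.fst)).trans (Set.ncard_image_le hD)
    rintro _ ⟨κ, hκ, rfl⟩
    obtain ⟨p, hp⟩ := (mem_filter.1 hκ).2
    exact ⟨_, hp, rfl⟩
  let r : {a // G.Adj c a} → Sym2 ({a // G.Adj c a} × (Bool × Fin (n + 3))) → Prop :=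
    fun l κ => ∃ a b, a ≠ b ∧ a ≠ l ∧ b ≠ l ∧ κ.map Prod.fst = s(a, b)
  have hcount : ∑ l, (K.filter (r l)).card ≤ K.card * 2 := by
    refine (sum_card_bipartiteAbove_eq_sum_card_bipartiteBelow (s := univ) (t := K) r).trans_le
      (sum_le_card_nsmul _ _ _ fun κ _ => ?_)
    by_cases hκ : ∃ a b, a ≠ b ∧ κ.map Prod.fst = s(a, b)
    · obtain ⟨a, b, hab, hκ⟩ := hκ
      calc _ ≤ (univ \ {a, b} : Finset {a // G.Adj c a}).card := card_le_card fun l hl => by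
            obtain ⟨a', b', -, ha, hb, h⟩ := (mem_filter.1 hl).2
            rw [hκ] at h
            rcases Sym2.eq_iff.1 h with ⟨rfl, rfl⟩ | ⟨rfl, rfl⟩ <;>
              simp [ha.symm, hb.symm]
        _ = 2 := by rw [card_sdiff_of_subset (subset_univ _), card_univ, hdeg, card_pair hab]
    · rw [card_eq_zero.2]
      · exact Nat.zero_le _
      · refine filter_eq_empty_iff.2 fun l _ => ?_
        rintro ⟨a, b, hab, -, -, h⟩
        exact hκ ⟨a, b, hab, h⟩
  have hblock : ∀ l, n + 3 ≤ (K.filter (r l)).card := by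
    intro l
    refine le_trans ?_ (card_image_le
      (f := Sym2.map fun x : {a // G.Adj c a} × (Bool × Fin (n + 3)) => (x.2.1, (x.2.2 : ℕ))))
    refine Blocking.le_card (by omega) fun i j k hij hjk hki => ?_
    have hcard : Fintype.card {x // x ≠ l} = 3 := by
      simp [Fintype.card_subtype_compl, hdeg]
    let T : Fin 3 → {x // x ≠ l} := (Fintype.equivFinOfCardEq hcard).symm
    have hT : Function.Injective fun x => (T x : {a // G.Adj c a}) :=
      Subtype.coe_injective.comp (Equiv.injective _)
    obtain ⟨a, b, u, v, hab, huv, p, hp⟩ :=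
      exists_crossing_mem_tripodPairs (D := D) _ hT hij hjk hki
    refine ⟨_, mem_image_of_mem _ (a := s(((T a).1, slotMod n u), ((T b).1, slotMod n v)))
      (mem_filter.2 ⟨mem_filter.2 ⟨mem_univ _, p, hp⟩, (T a).1, (T b).1, hT.ne hab, (T a).2,
        (T b).2, rfl⟩), huv⟩
  have := card_nsmul_le_sum univ _ _ fun l _ => hblock l
  rw [card_univ, hdeg, smul_eq_mul] at this
  omega

end Slots

section Wheel

/-- Polar coordinates, with the full angle divided into `N` units. -/
noncomputable def polar (N : ℕ) (r θ : ℝ) : ℝ × ℝ :=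
  (r * Real.cos (2 * Real.pi * θ / N), r * Real.sin (2 * Real.pi * θ / N))

lemma polar_add_self {N : ℕ} (hN : N ≠ 0) (r θ : ℝ) : polar N r (θ + N) = polar N r θ := by
  have hN' : (N : ℝ) ≠ 0 := Nat.cast_ne_zero.2 hN
  have : 2 * Real.pi * (θ + N) / N = 2 * Real.pi * θ / N + 2 * Real.pi := by field_simp
  simp [polar, this]

lemma eq_of_polar_eq {N : ℕ} (hN : N ≠ 0) {r r' θ θ' : ℝ} (hr : 0 < r) (hr' : 0 < r')
    (h1 : θ < θ' + N) (h2 : θ' < θ + N) (h : polar N r θ = polar N r' θ') :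
    r = r' ∧ θ = θ' := by
  have hN' : (N : ℝ) ≠ 0 := Nat.cast_ne_zero.2 hN
  simp only [polar, Prod.mk.injEq] at h
  obtain ⟨hc, hs⟩ := h
  set α := 2 * Real.pi * θ / N
  set β := 2 * Real.pi * θ' / N
  have hrr : r = r' := by
    have e : r ^ 2 = r' ^ 2 := by
      calc r ^ 2 = (r * Real.cos α) ^ 2 + (r * Real.sin α) ^ 2 := by
            rw [mul_pow, mul_pow, ← mul_add, Real.cos_sq_add_sin_sq, mul_one]
        _ = r' ^ 2 := by
            rw [hc, hs, mul_pow, mul_pow, ← mul_add, Real.cos_sq_add_sin_sq, mul_one]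
    exact (pow_left_inj₀ hr.le hr'.le two_ne_zero).1 e
  subst hrr
  refine ⟨rfl, ?_⟩
  obtain ⟨k, hk⟩ := Real.Angle.angle_eq_iff_two_pi_dvd_sub.1
    (Real.Angle.cos_sin_inj (mul_left_cancel₀ hr.ne' hc) (mul_left_cancel₀ hr.ne' hs))
  have hkN : θ = θ' + k * N := by
    have : 2 * Real.pi * (θ - θ') = 2 * Real.pi * (k * N) := by
      simp only [α, β] at hk
      field_simp at hk
      linear_combination Real.pi * 2 * hk
    linarith [mul_left_cancel₀ (by positivity) this]
  have hpos : (0 : ℝ) < N := by positivity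
  have k1 : (k : ℝ) < 1 := by nlinarith
  have k2 : (-1 : ℝ) < k := by nlinarith
  have k0 : k = 0 := by
    have : k < 1 := by exact_mod_cast k1
    have : -1 < k := by exact_mod_cast k2
    omega
  simpa [k0] using hkN

/-- The angular offset of the edge from ray position `a` to ray position `b`: rails move on by one
unit, path edges stay on their ray, chords leave it temporarily. -/
noncomputable def offset (a b : ℕ) (τ : ℝ) : ℝ :=
  if a = b then τ else (b - a - 1) * (τ * (1 - τ))

/-- The curve drawn for the edge from position `a` to position `b` starting on ray `i`. -/
noncomputable def wheelCurve (N a b i : ℕ) (τ : ℝ) : ℝ × ℝ :=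
  polar N (a + 1 + τ * (b - a)) (i + offset a b τ)

/-- Pairs of positions that are joined by a curve. -/
def WheelStep (a b : ℕ) : Prop := b = a ∨ b = a + 1 ∨ b = a + 2 ∧ (a = 1 ∨ a = 3)

lemma WheelStep.cases {a b : ℕ} (h : WheelStep a b) (τ : ℝ) :
    b = a ∧ (a + 1 + τ * (b - a) : ℝ) = a + 1 ∧ offset a b τ = τ ∨
    b = a + 1 ∧ (a + 1 + τ * (b - a) : ℝ) = a + 1 + τ ∧ offset a b τ = 0 ∨
    b = a + 2 ∧ (a = 1 ∨ a = 3) ∧ (a + 1 + τ * (b - a) : ℝ) = a + 1 + 2 * τ ∧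
      offset a b τ = τ * (1 - τ) := by
  rcases h with rfl | rfl | ⟨rfl, h⟩
  · simp [offset]
  · simp [offset]
  · refine .inr (.inr ⟨rfl, h, ?_, ?_⟩)
    · push_cast; ring
    · rw [offset, if_neg (by omega)]; push_cast; ring

lemma WheelStep.radius_pos {a b : ℕ} (h : WheelStep a b) {τ : ℝ} (hτ : 0 ≤ τ) :
    (0 : ℝ) < a + 1 + τ * (b - a) := by
  have : (0 : ℝ) ≤ a := Nat.cast_nonneg a
  rcases h.cases τ with ⟨-, h, -⟩ | ⟨-, h, -⟩ | ⟨-, -, h, -⟩ <;> rw [h] <;> linarith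

lemma WheelStep.offset_mem {a b : ℕ} (h : WheelStep a b) {τ : ℝ} (hτ : τ ∈ Set.Ioo (0 : ℝ) 1) :
    0 ≤ offset a b τ ∧ offset a b τ < 1 := by
  obtain ⟨h0, h1⟩ := hτ
  rcases h.cases τ with ⟨-, -, h⟩ | ⟨-, -, h⟩ | ⟨-, -, -, h⟩ <;> rw [h] <;>
    constructor <;> nlinarith

lemma natCast_eq_of_add_eq_add {i j : ℕ} {s t : ℝ} (hs : 0 ≤ s) (hs' : s < 1) (ht : 0 ≤ t)
    (ht' : t < 1) (h : (i + s : ℝ) = j + t) : i = j ∧ s = t := by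
  have h1 : (i : ℝ) < j + 1 := by linarith
  have h2 : (j : ℝ) < i + 1 := by linarith
  have h3 : i < j + 1 := by exact_mod_cast h1
  have h4 : j < i + 1 := by exact_mod_cast h2
  obtain rfl : i = j := by omega
  exact ⟨rfl, by linarith⟩

lemma WheelStep.injOn {N a b : ℕ} (h : WheelStep a b) (hN : 1 < N) (i : ℕ) :
    Set.InjOn (wheelCurve N a b i) (Set.Icc 0 1) := by
  rintro s ⟨hs0, hs1⟩ t ⟨ht0, ht1⟩ hst
  have hN' : (1 : ℝ) < N := by exact_mod_cast hN
  have hoff : ∀ {τ : ℝ}, 0 ≤ τ → τ ≤ 1 → 0 ≤ offset a b τ ∧ offset a b τ ≤ 1 := by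
    intro τ h0 h1
    rcases h.cases τ with ⟨-, -, h⟩ | ⟨-, -, h⟩ | ⟨-, -, -, h⟩ <;> rw [h] <;>
      constructor <;> nlinarith
  have hs := hoff hs0 hs1
  have ht := hoff ht0 ht1
  obtain ⟨hr, hθ⟩ := eq_of_polar_eq (by omega) (h.radius_pos hs0) (h.radius_pos ht0)
    (by linarith) (by linarith) hst
  rcases h.cases s with ⟨e, h1, h2⟩ | ⟨e, h1, h2⟩ | ⟨e, -, h1, h2⟩ <;>
    rcases h.cases t with ⟨e', h1', h2'⟩ | ⟨e', h1', h2'⟩ | ⟨e', -, h1', h2'⟩ <;>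
    first | omega | (rw [h1, h1'] at hr; rw [h2, h2'] at hθ; linarith)

lemma WheelStep.ne_polar {N a b i : ℕ} (h : WheelStep a b) (hi : i < N) {τ : ℝ}
    (hτ : τ ∈ Set.Ioo (0 : ℝ) 1) (w : ℕ) {j : ℕ} (hj : j < N) :
    wheelCurve N a b i τ ≠ polar N (w + 1) j := by
  intro he
  have hi' : (i + 1 : ℝ) ≤ N := by exact_mod_cast hi
  have hj' : (j : ℝ) < N := by exact_mod_cast hj
  have hi0 : (0 : ℝ) ≤ i := Nat.cast_nonneg i
  have hj0 : (0 : ℝ) ≤ j := Nat.cast_nonneg j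
  have ho := h.offset_mem hτ
  obtain ⟨hr, hθ⟩ := eq_of_polar_eq (by omega) (h.radius_pos hτ.1.le) (by positivity)
    (by linarith) (by linarith) he
  obtain ⟨-, hθ⟩ := natCast_eq_of_add_eq_add ho.1 ho.2 le_rfl one_pos (hθ.trans (add_zero _).symm)
  obtain ⟨h0, h1⟩ := hτ
  rcases h.cases τ with ⟨-, h, h'⟩ | ⟨-, h, h'⟩ | ⟨-, -, h, h'⟩
  · linarith
  · rw [h] at hr
    have := (natCast_eq_of_add_eq_add (i := a) (j := w) h0.le h1 le_rfl one_pos (by linarith)).2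
    linarith
  · nlinarith

lemma WheelStep.crossing {N a b i a' b' i' : ℕ} (h : WheelStep a b) (h' : WheelStep a' b')
    (hi : i < N) (hi' : i' < N) {s t : ℝ} (hs : s ∈ Set.Ioo (0 : ℝ) 1)
    (ht : t ∈ Set.Ioo (0 : ℝ) 1) (he : wheelCurve N a b i s = wheelCurve N a' b' i' t) :
    i = i' ∧ (a = a' ∧ b = b' ∨
      (a = 1 ∨ a = 3) ∧ b = a + 2 ∧ a' = a + 1 ∧ b' = a + 1 ∧
        wheelCurve N a b i s = polar N (a + 2) (i + 1 / 4) ∨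
      (a' = 1 ∨ a' = 3) ∧ b' = a' + 2 ∧ a = a' + 1 ∧ b = a' + 1 ∧
        wheelCurve N a b i s = polar N (a' + 2) (i + 1 / 4)) := by
  have hN : (i + 1 : ℝ) ≤ N := by exact_mod_cast hi
  have hN' : (i' + 1 : ℝ) ≤ N := by exact_mod_cast hi'
  have hi0 : (0 : ℝ) ≤ i := Nat.cast_nonneg i
  have hi0' : (0 : ℝ) ≤ i' := Nat.cast_nonneg i'
  have ho := h.offset_mem hs
  have ho' := h'.offset_mem ht
  obtain ⟨hr, hθ⟩ := eq_of_polar_eq (by omega) (h.radius_pos hs.1.le) (h'.radius_pos ht.1.le)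
    (by linarith) (by linarith) he
  obtain ⟨rfl, hθ⟩ := natCast_eq_of_add_eq_add ho.1 ho.2 ho'.1 ho'.2 hθ
  refine ⟨rfl, ?_⟩
  obtain ⟨hs0, hs1⟩ := hs
  obtain ⟨ht0, ht1⟩ := ht
  have half : ∀ {a a' : ℕ} {s : ℝ}, 0 < s → s < 1 → (a + 2 * s : ℝ) = a' →
      a' = a + 1 ∧ s = 1 / 2 := by
    intro a a' s hs0 hs1 h
    have h1 : (a : ℝ) < a' := by linarith
    have h2 : (a' : ℝ) < a + 2 := by linarith
    have h3 : a < a' := by exact_mod_cast h1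
    have h4 : a' < a + 2 := by exact_mod_cast h2
    obtain rfl : a' = a + 1 := by omega
    push_cast at h
    exact ⟨rfl, by linarith⟩
  rcases h.cases s with ⟨e, h1, h2⟩ | ⟨e, h1, h2⟩ | ⟨e, ha, h1, h2⟩ <;>
    rcases h'.cases t with ⟨e', h1', h2'⟩ | ⟨e', h1', h2'⟩ | ⟨e', ha', h1', h2'⟩ <;>
    rw [h1, h1'] at hr <;> rw [h2, h2'] at hθ
  · obtain rfl : a = a' := by exact_mod_cast (by linarith : (a : ℝ) = a')
    exact .inl ⟨rfl, by omega⟩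
  · linarith
  · obtain ⟨rfl, rfl⟩ := half ht0 ht1 (by linarith : (a' + 2 * t : ℝ) = a)
    refine .inr (.inr ⟨ha', e', rfl, e, ?_⟩)
    have hs : s = 1 / 4 := by linarith
    rw [wheelCurve, h1, h2, hs]
    push_cast
    ring_nf
  · linarith
  · obtain ⟨rfl, -⟩ := natCast_eq_of_add_eq_add (i := a) (j := a') hs0.le hs1 ht0.le ht1
      (by linarith)
    exact .inl ⟨rfl, by omega⟩
  · nlinarith
  · obtain ⟨rfl, rfl⟩ := half hs0 hs1 (by linarith : (a + 2 * s : ℝ) = a')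
    refine .inr (.inl ⟨ha, e, rfl, e', ?_⟩)
    rw [wheelCurve, h1, h2]
    ring_nf
  · nlinarith
  · left
    have : a = a' := by
      rcases ha with rfl | rfl <;> rcases ha' with rfl | rfl <;> first | rfl | norm_num at hr
      · linarith
      · linarith
    omega

lemma wheelStep_of_adj {a b : Fin 6} (h : G6_64.Adj a b) (hab : a < b) : WheelStep a b := by
  revert a b
  simp only [G6_64, SimpleGraph.fromEdgeSet_adj, WheelStep, Set.mem_insert_iff,
    Set.mem_singleton_iff]
  decide

/-- The edge starting in position `a` on ray `i` and ending in position `b`. -/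
def wheelEdge {n : ℕ} (a b : Fin 6) (i : Fin (n + 3)) : Sym2 (Fin 6 × Fin (n + 3)) :=
  s((a, i), (b, if a = b then i + 1 else i))

lemma exists_wheelEdge_eq {n : ℕ} (e : (G6_64 □ cycleGraph (n + 3)).edgeSet) :
    ∃ a b : Fin 6, ∃ i, WheelStep a b ∧ (e : Sym2 (Fin 6 × Fin (n + 3))) = wheelEdge a b i := by
  obtain ⟨e, he⟩ := e
  induction e with | _ x y
  obtain ⟨u, i⟩ := x
  obtain ⟨v, j⟩ := y
  rw [SimpleGraph.mem_edgeSet, boxProd_adj] at he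
  rcases he with ⟨h, rfl⟩ | ⟨h, rfl⟩
  · dsimp only at h ⊢
    rcases h.ne.lt_or_gt with hlt | hlt
    · exact ⟨u, v, i, wheelStep_of_adj h hlt, by simp [wheelEdge, h.ne]⟩
    · exact ⟨v, u, i, wheelStep_of_adj h.symm hlt, by simp [wheelEdge, h.ne']⟩
  · dsimp only at h ⊢
    rw [cycleGraph_adj] at h
    rcases h with h | h
    · exact ⟨u, u, j, .inl rfl, by simp [wheelEdge, ← h]⟩
    · exact ⟨u, u, i, .inl rfl, by simp [wheelEdge, ← h]⟩

lemma polar_val_add_one {n : ℕ} (r : ℝ) (i : Fin (n + 3)) :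
    polar (n + 3) r ((i + 1 : Fin (n + 3)) : ℕ) = polar (n + 3) r ((i : ℕ) + 1) := by
  rw [Fin.val_add_one]
  split_ifs with h
  · rw [h, ← polar_add_self (by omega)]
    simp
    ring_nf
  · push_cast; rfl

/-- The graph `G⁶₆₄ □ Cₙ` can be drawn with `2n` crossings. -/
theorem exists_drawing_ncard_crossings_le (n : ℕ) :
    ∃ D : Drawing (G6_64 □ cycleGraph (n + 3)),
      D.crossings.Finite ∧ D.crossings.ncard ≤ 2 * (n + 3) := by
  choose a b i hab he using exists_wheelEdge_eq (n := n)
  let D : Drawing (G6_64 □ cycleGraph (n + 3)) :=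
    { vertexMap := fun x => polar (n + 3) ((x.1 : ℕ) + 1) (x.2 : ℕ)
      vertexMap_injective := by
        rintro ⟨u, i⟩ ⟨v, j⟩ h
        have hi : ((i : ℕ) : ℝ) < (n + 3 : ℕ) := by exact_mod_cast i.2
        have hj : ((j : ℕ) : ℝ) < (n + 3 : ℕ) := by exact_mod_cast j.2
        have hi0 : (0 : ℝ) ≤ (i : ℕ) := Nat.cast_nonneg _
        have hj0 : (0 : ℝ) ≤ (j : ℕ) := Nat.cast_nonneg _
        obtain ⟨hr, hθ⟩ := eq_of_polar_eq (by omega) (by positivity) (by positivity)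
          (by linarith) (by linarith) h
        refine Prod.ext (Fin.ext ?_) (Fin.ext ?_)
        · exact_mod_cast add_right_cancel hr
        · exact_mod_cast hθ
      arc := fun e => wheelCurve (n + 3) (a e) (b e) (i e)
      arc_continuousOn := fun e => by
        refine Continuous.continuousOn ?_
        unfold wheelCurve polar offset
        split_ifs <;> fun_prop
      arc_injOn := fun e => (hab e).injOn (by omega) _
      arc_endpoints := fun e => by
        refine ⟨_, _, he e, ?_, ?_⟩
        · simp [wheelCurve, offset]
        · split_ifs with h
          · rw [polar_val_add_one]
            simp [wheelCurve, offset, h]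
          · simp [wheelCurve, offset, Fin.val_ne_of_ne h, add_right_comm]
      arc_avoids_vertices := fun e t ht w => (hab e).ne_polar (i e).2 ht _ w.2.2 }
  let S : Finset (Fin 6 × Fin (n + 3)) := {1, 3} ×ˢ Finset.univ
  let g : Fin 6 × Fin (n + 3) → Sym2 (Sym2 (Fin 6 × Fin (n + 3))) × (ℝ × ℝ) := fun x =>
    (s(wheelEdge x.1 (x.1 + 2) x.2, wheelEdge (x.1 + 1) (x.1 + 1) x.2),
      polar (n + 3) ((x.1 : ℕ) + 2) ((x.2 : ℕ) + 1 / 4))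
  have hinj : Function.Injective fun x : Sym2 (G6_64 □ cycleGraph (n + 3)).edgeSet × (ℝ × ℝ) =>
      (x.1.map Subtype.val, x.2) := by
    rintro ⟨x, p⟩ ⟨y, q⟩ h
    rw [Prod.mk.injEq] at h
    exact Prod.ext (Sym2.map.injective Subtype.val_injective h.1) h.2
  have hmem : ∀ e f : (G6_64 □ cycleGraph (n + 3)).edgeSet, i e = i f →
      ((a e : ℕ) = 1 ∨ (a e : ℕ) = 3) → (b e : ℕ) = a e + 2 → (a f : ℕ) = a e + 1 →
      (b f : ℕ) = a e + 1 → (s((e : Sym2 _), (f : Sym2 _)),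
        polar (n + 3) ((a e : ℕ) + 2) ((i e : ℕ) + 1 / 4)) ∈ S.image g := by
    intro e f hi ha hb ha' hb'
    have h1 : b e = a e + 2 := Fin.ext (by rw [hb, Fin.val_add]; simp; omega)
    have h2 : a f = a e + 1 := Fin.ext (by rw [ha', Fin.val_add]; simp; omega)
    have h3 : b f = a e + 1 := Fin.ext (by rw [hb', Fin.val_add]; simp; omega)
    refine Finset.mem_image.2 ⟨(a e, i e), ?_, ?_⟩
    · simp [S, Fin.ext_iff, ha]
    · rw [he e, he f, h1, h2, h3, ← hi]
  have hsub : (fun x : Sym2 (G6_64 □ cycleGraph (n + 3)).edgeSet × (ℝ × ℝ) =>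
      (x.1.map Subtype.val, x.2)) '' D.crossings ⊆ S.image g := by
    rintro _ ⟨⟨_, p⟩, ⟨e, f, hef, rfl, ⟨s, hs, rfl⟩, t, ht, hst⟩, rfl⟩
    obtain ⟨hi, h⟩ := (hab e).crossing (hab f) (i e).2 (i f).2 hs ht hst.symm
    have hi := Fin.ext hi
    rcases h with ⟨ha, hb⟩ | ⟨ha, hb, ha', hb', hp⟩ | ⟨ha, hb, ha', hb', hp⟩
    · exact absurd (Subtype.ext (by rw [he e, he f, Fin.ext ha, Fin.ext hb, hi])) hef
    · have := hmem e f hi ha hb ha' hb'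
      rwa [← hp] at this
    · have := hmem f e hi.symm ha hb ha' hb'
      rwa [← hi, ← hp, Sym2.eq_swap] at this
  have hfin : D.crossings.Finite :=
    Set.Finite.of_finite_image ((Finset.finite_toSet _).subset hsub) hinj.injOn
  refine ⟨D, hfin, ?_⟩
  calc D.crossings.ncard = _ := (Set.ncard_image_of_injective _ hinj).symm
    _ ≤ _ := Set.ncard_le_ncard hsub (Finset.finite_toSet _)
    _ = (S.image g).card := Set.ncard_coe_finset _
    _ ≤ S.card := Finset.card_image_le
    _ = 2 * (n + 3) := by simp [S]

end Wheel

/-- The crossing number of `G⁶₆₄ □ Cₙ` is `2n` for all `n ≥ 6`. -/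
theorem crossingNumber_G6_64_boxProd_cycle (n : ℕ) (hn : 6 ≤ n) :
    crossingNumber (G6_64 □ SimpleGraph.cycleGraph n) = 2 * n := by
  obtain ⟨m, rfl⟩ : ∃ m, n = m + 3 := ⟨n - 3, by omega⟩
  have : DecidableRel G6_64.Adj := fun a b => by
    unfold G6_64
    infer_instance
  have hdeg : Fintype.card {a // G6_64.Adj 3 a} = 4 := by
    rw [Fintype.card_subtype]
    simp only [G6_64, SimpleGraph.fromEdgeSet_adj, Set.mem_insert_iff, Set.mem_singleton_iff]
    decide
  obtain ⟨D, hD, hle⟩ := exists_drawing_ncard_crossings_le m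
  have hmem : D.crossings.ncard ∈ {k | ∃ D : Drawing (G6_64 □ cycleGraph (m + 3)),
      D.crossings.Finite ∧ D.crossings.ncard = k} := ⟨D, hD, rfl⟩
  refine le_antisymm ((Nat.sInf_le hmem).trans hle) ?_
  obtain ⟨D', hD', h⟩ := Nat.sInf_mem ⟨_, hmem⟩
  exact (two_mul_le_ncard_crossings_s3 (by omega) hdeg D' hD').trans_eq h
end
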